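/- Fix κ ∈ (0,1) and γ > 0 with γ > g_MLE(κ), i.e. κ > min_{t∈ℝ} E[(Z − tV)₊²]. Consider a sequence of logistic models with n observations and p = p(n) predictors, p/n → κ, rows X_i i.i.d. N(0, n⁻¹Iₚ), responses y_i ∈ {0,1} with P(y_i = 1 | X_i) = ρ'(X_i'β), and regression vectors β = β(n) satisfying lim_{n→∞} ‖β‖²/n = γ². Then the probability that the maximum-likelihood estimator exists (i.e. that the negative log-likelihood ℓ(b) = Σ_{i=1}^n {ρ(X_i'b) − y_i X_i'b} attains its minimum at a finite point) converges to 0 as n → ∞. -/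

import Mathlib

open MeasureTheory ProbabilityTheory Filter
open scoped Topology NNReal ENNReal

noncomputable section

/-- `ρ(t) = log(1 + eᵗ)`. -/
def rho (t : ℝ) : ℝ := Real.log (1 + Real.exp t)

/-- The sigmoid `ρ'(t) = eᵗ/(1+eᵗ)`. -/
def rho' (t : ℝ) : ℝ := Real.exp t / (1 + Real.exp t)

/-- `ρ''(t) = ρ'(t)(1 - ρ'(t))`. -/
def rho'' (t : ℝ) : ℝ := rho' t * (1 - rho' t)

/-- The proximal operator `prox_{λρ}(z)`, characterized by `t + λρ'(t) = z`. -/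
def prox (lam z : ℝ) : ℝ := Function.invFun (fun t : ℝ => t + lam * rho' t) z

/-- Standard Gaussian measure on `ℝ`. -/
def gauss : Measure ℝ := gaussianReal 0 1

/-- Uniform measure on `[0,1]`. -/
def unif : Measure ℝ := volume.restrict (Set.Icc (0 : ℝ) 1)

/-- `g_MLE⁻¹(γ) = min_t E[(Z - tV)₊²]`, where `Z` is standard normal and `V` is an
independent variable with density `2ρ'(γ·)φ(·)`. -/
def gMLEinv (γ : ℝ) : ℝ :=
  ⨅ t : ℝ, ∫ z, (∫ v, (max (z - t * v) 0) ^ 2 * (2 * rho' (γ * v)) ∂gauss) ∂gauss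

/-- Negative log-likelihood of the logistic model. -/
def negLogLik {n p : ℕ} (X : Fin n → Fin p → ℝ) (y : Fin n → ℝ) (b : Fin p → ℝ) : ℝ :=
  ∑ i, (rho (∑ j, X i j * b j) - y i * ∑ j, X i j * b j)

/-- Logistic responses: `y_i = 1(U_i ≤ ρ'(X_i'β))`, so that `P(y_i = 1 | X_i) = ρ'(X_i'β)`. -/
def resp {n p : ℕ} (X : Fin n → Fin p → ℝ) (U : Fin n → ℝ) (β : Fin p → ℝ) : Fin n → ℝ :=
  fun i => if U i ≤ rho' (∑ j, X i j * β j) then 1 else 0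

/-- Joint law of the design matrix (i.i.d. `N(0, n⁻¹ I_p)` rows) and of independent
uniform variables used to generate logistic responses. -/
def designLaw (n p : ℕ) : Measure ((Fin n → Fin p → ℝ) × (Fin n → ℝ)) :=
  (Measure.pi fun _ : Fin n => Measure.pi fun _ : Fin p => gaussianReal 0 ((n : ℝ≥0))⁻¹).prod
    (Measure.pi fun _ : Fin n => unif)

/-- Iterated expectation over two independent standard Gaussians. -/
def E2 (f : ℝ → ℝ → ℝ) : ℝ := ∫ z1, (∫ z2, f z1 z2 ∂gauss) ∂gauss

/-- The system (S) of three nonlinear equations in `(α, σ, λ)`, with parameters `(κ, γ)`.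
Here `(Q₁, Q₂) = (γ Z₁, -αγ Z₁ + √κ σ Z₂)` is the centered bivariate Gaussian with
`Var(Q₁) = γ²`, `Cov(Q₁, Q₂) = -αγ²`, `Var(Q₂) = α²γ² + κσ²`. -/
def solvesS (κ γ α σ lam : ℝ) : Prop :=
  σ ^ 2 = (1 / κ ^ 2) *
      E2 (fun z1 z2 => 2 * rho' (γ * z1) *
        (lam * rho' (prox lam (-(α * γ) * z1 + Real.sqrt κ * σ * z2))) ^ 2) ∧
  0 = E2 (fun z1 z2 => rho' (γ * z1) * (γ * z1) *
        (lam * rho' (prox lam (-(α * γ) * z1 + Real.sqrt κ * σ * z2)))) ∧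
  1 - κ = E2 (fun z1 z2 => 2 * rho' (γ * z1) /
        (1 + lam * rho'' (prox lam (-(α * γ) * z1 + Real.sqrt κ * σ * z2))))

/-- The primitive `b ↦ ∫₀ᵇ e^{l x²} dx`. -/
def expSqPrimitive (l b : ℝ) : ℝ := ∫ x in (0 : ℝ)..b, Real.exp (l * x ^ 2)

/-- The function `a ↦ a e^{l a²}`. -/
def mulExpSq (l a : ℝ) : ℝ := a * Real.exp (l * a ^ 2)

/-- The function `a ↦ a² e^{l a²}`. -/
def sqExpSq (l a : ℝ) : ℝ := a ^ 2 * Real.exp (l * a ^ 2)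

lemma hasStrictDerivAt_expSqPrimitive (l b : ℝ) :
    HasStrictDerivAt (expSqPrimitive l) (Real.exp (l * b ^ 2)) b := by
  have hc : Continuous fun x : ℝ => Real.exp (l * x ^ 2) := by fun_prop
  exact intervalIntegral.integral_hasStrictDerivAt_right (hc.intervalIntegrable _ _)
    (hc.stronglyMeasurableAtFilter _ _) hc.continuousAt

lemma hasStrictDerivAt_mulExpSq (l a : ℝ) :
    HasStrictDerivAt (mulExpSq l) ((1 + 2 * l * a ^ 2) * Real.exp (l * a ^ 2)) a := by
  have h : HasStrictDerivAt (fun a : ℝ => l * a ^ 2) (l * (2 * a)) a := by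
    simpa using (hasStrictDerivAt_pow 2 a).const_mul l
  convert! (hasStrictDerivAt_id a).mul h.exp using 1
  simp only [id]; ring

lemma continuous_expSqPrimitive (l : ℝ) : Continuous (expSqPrimitive l) :=
  continuous_iff_continuousAt.2 fun b => (hasStrictDerivAt_expSqPrimitive l b).hasDerivAt.continuousAt

lemma continuous_mulExpSq (l : ℝ) : Continuous (mulExpSq l) := by
  unfold mulExpSq; fun_prop

lemma continuous_sqExpSq (l : ℝ) : Continuous (sqExpSq l) := by
  unfold sqExpSq; fun_prop

lemma sqExpSq_nonneg (l a : ℝ) : 0 ≤ sqExpSq l a := by unfold sqExpSq; positivity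

lemma sqExpSq_le_sqExpSq {l a b : ℝ} (hl : 0 ≤ l) (ha : 0 ≤ a) (hab : a ≤ b) :
    sqExpSq l a ≤ sqExpSq l b := by
  unfold sqExpSq; gcongr

lemma sqExpSq_div_cos_eq {l a : ℝ} {x : ℝ} (hx : Real.cos x ≠ 0) :
    mulExpSq l a * (Real.exp (l * (a * Real.tan x) ^ 2) * (a * (1 / Real.cos x ^ 2))) =
      sqExpSq l (a / Real.cos x) := by
  have h : l * (a / Real.cos x) ^ 2 = l * a ^ 2 + l * (a * Real.tan x) ^ 2 := by
    rw [Real.tan_eq_sin_div_cos]; field_simp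
    linear_combination (-(l * a ^ 2)) * Real.sin_sq_add_cos_sq x
  rw [sqExpSq, mulExpSq, h, Real.exp_add]; ring

/-- Integral of `sqExpSq l (a / cos x)` in terms of the explicit primitive. -/
lemma integral_sqExpSq_div_cos (l a s t : ℝ) :
    ∫ x in Real.arctan s..Real.arctan t, sqExpSq l (a / Real.cos x) =
      mulExpSq l a * (expSqPrimitive l (a * t) - expSqPrimitive l (a * s)) := by
  have hsub : ∀ x ∈ Set.uIcc (Real.arctan s) (Real.arctan t), 0 < Real.cos x := by
    intro x hx
    have h1 := (Set.mem_uIcc.1 hx)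
    apply Real.cos_pos_of_mem_Ioo
    have := Real.neg_pi_div_two_lt_arctan s
    have := Real.neg_pi_div_two_lt_arctan t
    have := Real.arctan_lt_pi_div_two s
    have := Real.arctan_lt_pi_div_two t
    constructor <;> rcases h1 with h | h <;> linarith [h.1, h.2]
  rw [intervalIntegral.integral_eq_sub_of_hasDerivAt
    (f := fun x => mulExpSq l a * expSqPrimitive l (a * Real.tan x))]
  · simp only [Real.tan_arctan]; ring
  · intro x hx
    have hc := (hsub x hx).ne'
    rw [← sqExpSq_div_cos_eq hc]
    exact ((hasStrictDerivAt_expSqPrimitive l (a * Real.tan x)).hasDerivAt.comp x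
      ((Real.hasDerivAt_tan hc).const_mul a)).const_mul _
  · apply ContinuousOn.intervalIntegrable
    refine (continuous_sqExpSq l).comp_continuousOn ?_
    exact continuousOn_const.div Real.continuous_cos.continuousOn fun x hx => (hsub x hx).ne'

/-- Angle of the intersection point of two supporting lines whose normals make an angle `d`. -/
lemma arctan_div_eq_add_arctan_div {x y d : ℝ} (hx : 0 < x) (hy : 0 < y) (hd : 0 < d)
    (hd' : d < Real.pi / 2) :
    Real.arctan ((y - x * Real.cos d) / Real.sin d / x) =
      d + Real.arctan ((y * Real.cos d - x) / Real.sin d / y) := by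
  have hs : 0 < Real.sin d := Real.sin_pos_of_pos_of_lt_pi hd (by linarith)
  set p := Real.arctan ((y * Real.cos d - x) / Real.sin d / y) with hp
  have htan : Real.tan p = (y * Real.cos d - x) / Real.sin d / y := Real.tan_arctan _
  have hcp : 0 < Real.cos p := Real.cos_arctan_pos _
  have hsp : Real.sin p = Real.cos p * ((y * Real.cos d - x) / Real.sin d / y) := by
    rw [← htan, Real.tan_eq_sin_div_cos]; field_simp
  have h1 := Real.neg_pi_div_two_lt_arctan ((y * Real.cos d - x) / Real.sin d / y)
  have h2 := Real.arctan_lt_pi_div_two ((y * Real.cos d - x) / Real.sin d / y)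
  rw [← hp] at h1 h2
  have hcos : Real.cos (d + p) = Real.cos p * (x / y) := by
    rw [Real.cos_add, hsp]; field_simp; ring
  have hsin : Real.sin (d + p) = Real.cos p * ((y - x * Real.cos d) / (y * Real.sin d)) := by
    rw [Real.sin_add, hsp]; field_simp
    linear_combination y * Real.sin_sq_add_cos_sq d
  have hpos : 0 < Real.cos (d + p) := by rw [hcos]; positivity
  have hlt : d + p < Real.pi / 2 := by
    by_contra hcon
    push Not at hcon
    exact absurd (Real.cos_nonpos_of_pi_div_two_le_of_le hcon (by linarith)) (not_le.2 hpos)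
  rw [← Real.arctan_tan (x := d + p) (by linarith) hlt]
  congr 1
  rw [Real.tan_eq_sin_div_cos, hcos, hsin]; field_simp

/-- An averaged form of the fact that the radial function `u` of a planar convex set is bounded
through its support function `f`: both sides are integrals over all directions, and `d` is the
angle between neighbouring supporting lines. -/
lemma mul_integral_sqExpSq_le {l d : ℝ} (hl : 0 ≤ l) (hd : 0 < d) (hd' : d < Real.pi / 2)
    {f u : ℝ → ℝ} (hf : Continuous f) (hfpos : ∀ x, 0 < f x)
    (hfper : Function.Periodic f (2 * Real.pi))
    (hconv : ∀ x, 2 * Real.cos d * f x ≤ f (x - d) + f (x + d))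
    (hu : Measurable u) (hu0 : ∀ x, 0 ≤ u x) (huper : Function.Periodic u (2 * Real.pi))
    (huf : ∀ x y, 0 < Real.cos (y - x) → u x * Real.cos (y - x) ≤ f y) :
    d * ∫ x in (0 : ℝ)..2 * Real.pi, sqExpSq l (u x) ≤
      ∫ x in (0 : ℝ)..2 * Real.pi, mulExpSq l (f x) *
        (expSqPrimitive l ((f (x + d) - f x * Real.cos d) / Real.sin d) -
          expSqPrimitive l ((f x * Real.cos d - f (x - d)) / Real.sin d)) := by
  have hs : 0 < Real.sin d := Real.sin_pos_of_pos_of_lt_pi hd (by linarith)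
  set b : ℝ → ℝ := fun x => (f (x + d) - f x * Real.cos d) / Real.sin d with hb
  set b' : ℝ → ℝ := fun x => (f x * Real.cos d - f (x - d)) / Real.sin d with hb'
  have hbc : Continuous b := by fun_prop
  have hbc' : Continuous b' := by fun_prop
  have hbb : ∀ x, b' x ≤ b x := fun x => by
    simp only [hb, hb']; gcongr ?_ / _; linarith [hconv x]
  set α : ℝ → ℝ := fun x => x + Real.arctan (b x / f x) with hα
  have hαc : Continuous α := by
    have : Continuous fun x => b x / f x := hbc.div hf fun x => (hfpos x).ne'
    exact continuous_id.add (Real.continuous_arctan.comp this)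
  have hα' : ∀ x, α (x - d) = x + Real.arctan (b' x / f x) := by
    intro x
    have := arctan_div_eq_add_arctan_div (hfpos (x - d)) (hfpos x) hd hd'
    simp only [hα, hb, hb', sub_add_cancel]
    rw [this]; ring
  have hgm : Measurable fun x => sqExpSq l (u x) := (continuous_sqExpSq l).measurable.comp hu
  have hgper : Function.Periodic (fun x => sqExpSq l (u x)) (2 * Real.pi) := fun x => by
    simp only [huper x]
  obtain ⟨B, hB⟩ : ∃ B, ∀ x, sqExpSq l (u x) ≤ B := by
    obtain ⟨x, -, hx⟩ := isCompact_Icc.exists_isMaxOn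
      (Set.nonempty_Icc.2 (by positivity : (0 : ℝ) ≤ 2 * Real.pi)) hf.continuousOn
    refine ⟨sqExpSq l (f x), fun y => sqExpSq_le_sqExpSq hl (hu0 y) ?_⟩
    obtain ⟨z, hz, hzy⟩ := hfper.exists_mem_Ico₀ Real.two_pi_pos y
    have := huf y y (by simp)
    simp only [sub_self, Real.cos_zero, mul_one] at this
    rw [hzy] at this
    exact this.trans (hx ⟨hz.1, hz.2.le⟩)
  have hgi : ∀ a c, IntervalIntegrable (fun x => sqExpSq l (u x)) volume a c := by
    intro a c
    refine (intervalIntegrable_const (c := B)).mono_fun hgm.aestronglyMeasurable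
      (Eventually.of_forall fun x => ?_)
    simp only [Real.norm_eq_abs, abs_of_nonneg (sqExpSq_nonneg l (u x))]
    exact (hB x).trans (le_abs_self B)
  set H : ℝ → ℝ := fun y => ∫ x in (0 : ℝ)..y, sqExpSq l (u x) with hH
  have hHc : Continuous H := intervalIntegral.continuous_primitive hgi 0
  have hHper : ∀ y, H (y + 2 * Real.pi) = H y + H (2 * Real.pi) := by
    intro y
    simp only [hH]
    rw [← intervalIntegral.integral_add_adjacent_intervals (hgi 0 y) (hgi y _),
      hgper.intervalIntegral_add_eq y 0, zero_add]
  have hαper : ∀ x, α (x + 2 * Real.pi) = α x + 2 * Real.pi := by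
    intro x
    have h1 : x + 2 * Real.pi + d = (x + d) + 2 * Real.pi := by ring
    simp only [hα, hb, h1, hfper x, hfper (x + d)]; ring
  have hHα : Continuous fun x => H (α x) := hHc.comp hαc
  have key : ∀ x, H (α x) - H (α (x - d)) ≤
      mulExpSq l (f x) * (expSqPrimitive l (b x) - expSqPrimitive l (b' x)) := by
    intro x
    have hle : Real.arctan (b' x / f x) ≤ Real.arctan (b x / f x) :=
      Real.arctan_mono (by have := hfpos x; have := hbb x; gcongr)
    rw [hα' x]
    simp only [hH, hα]
    rw [intervalIntegral.integral_interval_sub_left (hgi _ _) (hgi _ _)]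
    have h1 : ∫ t in x + Real.arctan (b' x / f x)..x + Real.arctan (b x / f x), sqExpSq l (u t) =
        ∫ t in Real.arctan (b' x / f x)..Real.arctan (b x / f x), sqExpSq l (u (x + t)) := by
      rw [intervalIntegral.integral_comp_add_left (fun t => sqExpSq l (u t))]
    have h2 := integral_sqExpSq_div_cos l (f x) (b' x / f x) (b x / f x)
    rw [mul_div_cancel₀ _ (hfpos x).ne', mul_div_cancel₀ _ (hfpos x).ne'] at h2
    have hcos : ∀ t ∈ Set.Icc (Real.arctan (b' x / f x)) (Real.arctan (b x / f x)),
        0 < Real.cos t := fun t ht => Real.cos_pos_of_mem_Ioo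
      ⟨(Real.neg_pi_div_two_lt_arctan _).trans_le ht.1,
        ht.2.trans_lt (Real.arctan_lt_pi_div_two _)⟩
    rw [h1, ← h2]
    refine intervalIntegral.integral_mono_on hle ?_ ?_ fun t ht => ?_
    · have := (hgi (x + Real.arctan (b' x / f x)) (x + Real.arctan (b x / f x))).comp_add_left x
      simpa using this
    · apply ContinuousOn.intervalIntegrable
      refine (continuous_sqExpSq l).comp_continuousOn ?_
      rw [Set.uIcc_of_le hle]
      exact continuousOn_const.div Real.continuous_cos.continuousOn fun t ht => (hcos t ht).ne'
    · have hc := hcos t ht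
      refine sqExpSq_le_sqExpSq hl (hu0 _) ?_
      rw [le_div_iff₀ hc]
      have := huf (x + t) x (by simpa using hc)
      simpa using this
  have hHα' : Continuous fun x => H (α (x - d)) := hHα.comp (continuous_sub_right d)
  calc d * ∫ x in (0 : ℝ)..2 * Real.pi, sqExpSq l (u x)
      = ∫ x in (0 : ℝ)..2 * Real.pi, (H (α x) - H (α (x - d))) := by
        rw [intervalIntegral.integral_sub (hHα.intervalIntegrable _ _)
          (hHα'.intervalIntegrable _ _),
          intervalIntegral.integral_comp_sub_right (fun x => H (α x)) d]
        have e1 := intervalIntegral.integral_add_adjacent_intervals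
          (hHα.intervalIntegrable (μ := volume) 0 (2 * Real.pi - d))
          (hHα.intervalIntegrable (2 * Real.pi - d) (2 * Real.pi))
        have e2 := intervalIntegral.integral_add_adjacent_intervals
          (hHα.intervalIntegrable (μ := volume) (0 - d) 0)
          (hHα.intervalIntegrable 0 (2 * Real.pi - d))
        have e3 : ∫ x in (2 * Real.pi - d)..2 * Real.pi, H (α x) =
            ∫ x in (0 - d)..0, (H (α x) + H (2 * Real.pi)) := by
          simp only [← hHper, ← hαper]
          rw [intervalIntegral.integral_comp_add_right (fun x => H (α x))]
          congr 1 <;> ring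
        rw [intervalIntegral.integral_add (hHα.intervalIntegrable _ _) (by simp)] at e3
        simp only [intervalIntegral.integral_const, smul_eq_mul] at e3
        rw [← e1, ← e2, e3]
        simp only [hH]; ring
    _ ≤ _ := by
        refine intervalIntegral.integral_mono_on (by positivity)
          ((hHα.sub hHα').intervalIntegrable _ _) ?_ fun x _ => key x
        apply Continuous.intervalIntegrable
        exact ((continuous_mulExpSq l).comp hf).mul
          (((continuous_expSqPrimitive l).comp hbc).sub ((continuous_expSqPrimitive l).comp hbc'))

lemma gaussianPDFReal_zero_one (x : ℝ) :
    gaussianPDFReal 0 1 x = (√(2 * Real.pi))⁻¹ * Real.exp (-(1 / 2) * x ^ 2) := by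
  simp only [gaussianPDFReal]
  congr 2 <;> simp
  ring

lemma integrable_gaussianReal_iff {f : ℝ → ℝ} :
    Integrable f (gaussianReal 0 1) ↔
      Integrable (fun x => Real.exp (-(1 / 2) * x ^ 2) * f x) := by
  rw [gaussianReal_of_var_ne_zero _ one_ne_zero, integrable_withDensity_iff_integrable_smul'
    (measurable_gaussianPDF _ _) (by simp [gaussianPDF])]
  simp only [toReal_gaussianPDF, gaussianPDFReal_zero_one, smul_eq_mul, mul_assoc]
  exact integrable_const_mul_iff (IsUnit.mk0 _ (by positivity)) _

lemma integral_gaussianReal_zero_one (f : ℝ → ℝ) :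
    ∫ x, f x ∂gaussianReal 0 1 =
      (√(2 * Real.pi))⁻¹ * ∫ x, Real.exp (-(1 / 2) * x ^ 2) * f x := by
  rw [integral_gaussianReal_eq_integral_smul one_ne_zero, ← integral_const_mul]
  simp only [gaussianPDFReal_zero_one, smul_eq_mul, mul_assoc]

lemma integrable_exp_mul_sq_gaussianReal {c : ℝ} (hc : c < 1 / 2) :
    Integrable (fun x => Real.exp (c * x ^ 2)) (gaussianReal 0 1) := by
  rw [integrable_gaussianReal_iff]
  refine (integrable_exp_neg_mul_sq (b := 1 / 2 - c) (by linarith)).congr (ae_of_all _ fun x => ?_)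
  simp only [← Real.exp_add]; ring_nf

lemma integral_exp_mul_sq_gaussianReal {c : ℝ} (hc : c < 1 / 2) :
    ∫ x, Real.exp (c * x ^ 2) ∂gaussianReal 0 1 = (√(1 - 2 * c))⁻¹ := by
  rw [integral_gaussianReal_zero_one]
  have : ∀ x : ℝ, Real.exp (-(1 / 2) * x ^ 2) * Real.exp (c * x ^ 2) =
      Real.exp (-(1 / 2 - c) * x ^ 2) := fun x => by rw [← Real.exp_add]; ring_nf
  simp only [this, integral_gaussian]
  rw [← Real.sqrt_inv, ← Real.sqrt_inv, ← Real.sqrt_mul (by positivity)]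
  congr 1
  have : (1 / 2 - c) ≠ 0 := by linarith
  have : 1 - 2 * c ≠ 0 := by linarith
  have := Real.pi_pos
  field_simp

lemma abs_expSqPrimitive_sub_le {l : ℝ} (hl : 0 ≤ l) {a b M : ℝ} (ha : |a| ≤ M) (hb : |b| ≤ M) :
    |expSqPrimitive l b - expSqPrimitive l a| ≤ Real.exp (l * M ^ 2) * |b - a| := by
  have := (convex_Icc (-M) M).norm_image_sub_le_of_norm_hasDerivWithin_le (f := expSqPrimitive l)
    (f' := fun x => Real.exp (l * x ^ 2)) (C := Real.exp (l * M ^ 2)) (x := a) (y := b)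
    (fun x _ => (hasStrictDerivAt_expSqPrimitive l x).hasDerivAt.hasDerivWithinAt)
    (fun x hx => by
      rw [Real.norm_eq_abs, Real.abs_exp]
      exact Real.exp_le_exp.2 (mul_le_mul_of_nonneg_left
        (sq_le_sq' hx.1 hx.2) hl)) (abs_le.1 ha) (abs_le.1 hb)
  simpa using this

lemma expSqPrimitive_zero (l : ℝ) : expSqPrimitive l 0 = 0 := by simp [expSqPrimitive]

lemma abs_expSqPrimitive_le {l : ℝ} (hl : 0 ≤ l) {b M : ℝ} (hb : |b| ≤ M) :
    |expSqPrimitive l b| ≤ Real.exp (l * M ^ 2) * M := by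
  have := abs_expSqPrimitive_sub_le hl (a := 0) (by simpa using (abs_nonneg b).trans hb) hb
  rw [expSqPrimitive_zero, sub_zero, sub_zero] at this
  exact this.trans (by gcongr)

lemma sq_mul_exp_le {l c x : ℝ} (hlc : l < c) :
    x ^ 2 * Real.exp (l * x ^ 2) ≤ (c - l)⁻¹ * Real.exp (c * x ^ 2) := by
  have h0 : 0 < c - l := by linarith
  have h : (c - l) * x ^ 2 ≤ Real.exp ((c - l) * x ^ 2) := by
    linarith [Real.add_one_le_exp ((c - l) * x ^ 2)]
  have h2 : Real.exp (c * x ^ 2) = Real.exp ((c - l) * x ^ 2) * Real.exp (l * x ^ 2) := by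
    rw [← Real.exp_add]; ring_nf
  rw [h2, ← mul_assoc]
  gcongr
  rw [inv_mul_eq_div, le_div_iff₀ h0]
  linarith

lemma integrable_sq_mul_exp_gaussianReal {l : ℝ} (hl : l < 1 / 2) :
    Integrable (fun x => x ^ 2 * Real.exp (l * x ^ 2)) (gaussianReal 0 1) := by
  have h : l < (l + 1 / 2) / 2 := by linarith
  refine ((integrable_exp_mul_sq_gaussianReal (c := (l + 1 / 2) / 2) (by linarith)).const_mul
    ((l + 1 / 2) / 2 - l)⁻¹).mono' (by fun_prop) (ae_of_all _ fun x => ?_)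
  rw [Real.norm_of_nonneg (by positivity)]
  exact sq_mul_exp_le h

lemma integrable_mul_expSqPrimitive {l : ℝ} (hl : 0 ≤ l) (hl' : l < 1 / 2) :
    Integrable (fun x => x * expSqPrimitive l x) (gaussianReal 0 1) := by
  refine (integrable_sq_mul_exp_gaussianReal hl').mono'
    (continuous_id.mul (continuous_expSqPrimitive l)).aestronglyMeasurable
    (ae_of_all _ fun x => ?_)
  rw [norm_mul, Real.norm_eq_abs, Real.norm_eq_abs]
  calc |x| * |expSqPrimitive l x| ≤ |x| * (Real.exp (l * |x| ^ 2) * |x|) := by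
        gcongr; exact abs_expSqPrimitive_le hl le_rfl
    _ = x ^ 2 * Real.exp (l * x ^ 2) := by rw [← sq_abs x]; ring

lemma integral_mul_expSqPrimitive {l : ℝ} (hl : 0 ≤ l) (hl' : l < 1 / 2) :
    ∫ x, x * expSqPrimitive l x ∂gaussianReal 0 1 =
      ∫ x, Real.exp (l * x ^ 2) ∂gaussianReal 0 1 := by
  have hv : ∀ x : ℝ, HasDerivAt (fun x : ℝ => -Real.exp (-(1 / 2) * x ^ 2))
      (x * Real.exp (-(1 / 2) * x ^ 2)) x := fun x => by
    have := ((hasDerivAt_pow 2 x).const_mul (-(1 / 2) : ℝ)).exp.neg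
    convert! this using 1
    push_cast; ring
  have h_int := integrable_gaussianReal_iff.1 (integrable_exp_mul_sq_gaussianReal hl')
  have h1 := integrable_gaussianReal_iff.1 (integrable_mul_expSqPrimitive hl hl')
  have h2 : Integrable (fun x => Real.exp (-(1 / 2) * x ^ 2) * expSqPrimitive l x) := by
    rw [← integrable_gaussianReal_iff]
    refine ((integrable_sq_mul_exp_gaussianReal hl').add
      (integrable_exp_mul_sq_gaussianReal hl')).mono'
      (continuous_expSqPrimitive l).aestronglyMeasurable (ae_of_all _ fun x => ?_)
    have := abs_expSqPrimitive_le hl (b := x) le_rfl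
    rw [sq_abs] at this
    simp only [Pi.add_apply, Real.norm_eq_abs]
    refine this.trans ?_
    have hx : |x| ≤ x ^ 2 + 1 := by nlinarith [sq_abs x, sq_nonneg (|x| - 1), abs_nonneg x]
    nlinarith [Real.exp_pos (l * x ^ 2)]
  have := integral_mul_deriv_eq_deriv_mul_of_integrable (u := expSqPrimitive l)
    (fun x _ => (hasStrictDerivAt_expSqPrimitive l x).hasDerivAt) (fun x _ => hv x)
    (h1.congr (ae_of_all _ fun x => by simp only [Pi.mul_apply]; ring))
    (h_int.neg.congr (ae_of_all _ fun x => by simp only [Pi.mul_apply, Pi.neg_apply]; ring))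
    (h2.neg.congr (ae_of_all _ fun x => by simp only [Pi.mul_apply, Pi.neg_apply]; ring))
  rw [integral_gaussianReal_zero_one, integral_gaussianReal_zero_one]
  congr 1
  rw [← integral_neg] at this
  refine (integral_congr_ae (ae_of_all _ fun x => ?_)).trans
    (this.trans (integral_congr_ae (ae_of_all _ fun x => ?_))) <;> ring

lemma absolutelyContinuous_pi {ν ν' : Measure ℝ} [SigmaFinite ν] [SigmaFinite ν'] (h : ν ≪ ν') :
    ∀ n : ℕ, (Measure.pi fun _ : Fin n => ν) ≪ Measure.pi fun _ : Fin n => ν'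
  | 0 => by rw [Measure.pi_of_empty, Measure.pi_of_empty]
  | n + 1 => by
    have e1 := (measurePreserving_piFinSuccAbove (fun _ : Fin (n + 1) => ν) 0).symm
    have e2 := (measurePreserving_piFinSuccAbove (fun _ : Fin (n + 1) => ν') 0).symm
    rw [← e1.map_eq, ← e2.map_eq]
    exact (h.prod (absolutelyContinuous_pi h n)).map e1.measurable

section InnerProduct

variable {E : Type*} [NormedAddCommGroup E] [InnerProductSpace ℝ E] [FiniteDimensional ℝ E]
  [MeasurableSpace E] [BorelSpace E]

lemma stdGaussian_absolutelyContinuous : stdGaussian E ≪ (volume : Measure E) := by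
  set b := stdOrthonormalBasis ℝ E
  have hf : MeasurePreserving (fun x : Fin (Module.finrank ℝ E) → ℝ => ∑ i, x i • b i) := by
    have := b.measurePreserving_repr_symm.comp (PiLp.volume_preserving_toLp (Fin (Module.finrank ℝ E)))
    have e : (fun x : Fin (Module.finrank ℝ E) → ℝ => ∑ i, x i • b i) =
        b.repr.symm ∘ WithLp.toLp 2 := by
      funext x
      simp [Function.comp, ← b.sum_repr_symm]
    rw [e]
    exact this
  rw [stdGaussian, ← hf.map_eq]
  exact (absolutelyContinuous_pi (gaussianReal_absolutelyContinuous 0 one_ne_zero) _).map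
    hf.measurable

lemma integrable_exp_mul_norm_sq_stdGaussian {c : ℝ} (hc : c < 1 / 2) :
    Integrable (fun x : E => Real.exp (c * ‖x‖ ^ 2)) (stdGaussian E) := by
  have hm : Measurable (fun x : Fin (Module.finrank ℝ E) → ℝ =>
      ∑ i, x i • stdOrthonormalBasis ℝ E i) := by fun_prop
  rw [stdGaussian, integrable_map_measure (by fun_prop) hm.aemeasurable]
  refine (Integrable.fintype_prod (f := fun (_ : Fin (Module.finrank ℝ E)) (x : ℝ) =>
    Real.exp (c * x ^ 2)) fun _ => integrable_exp_mul_sq_gaussianReal hc).congr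
    (ae_of_all _ fun x => ?_)
  have : ‖∑ i, x i • stdOrthonormalBasis ℝ E i‖ ^ 2 = ∑ i, x i ^ 2 := by
    rw [← (stdOrthonormalBasis ℝ E).sum_sq_norm_inner_right]
    refine Finset.sum_congr rfl fun i _ => ?_
    rw [(stdOrthonormalBasis ℝ E).orthonormal.inner_right_fintype, Real.norm_eq_abs, sq_abs]
  simp only [Function.comp, this, Finset.mul_sum, Real.exp_sum]

lemma map_rotation_stdGaussian (θ : ℝ) :
    ((stdGaussian E).prod (stdGaussian E)).map (ContinuousLinearMap.rotation θ) =
      (stdGaussian E).prod (stdGaussian E) :=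
  IsGaussian.map_rotation_eq_self (by simp) θ

lemma measurePreserving_rotation (θ : ℝ) :
    MeasurePreserving (fun x : E × E => ContinuousLinearMap.rotation θ x)
      ((stdGaussian E).prod (stdGaussian E)) ((stdGaussian E).prod (stdGaussian E)) :=
  ⟨(ContinuousLinearMap.rotation θ).continuous.measurable, map_rotation_stdGaussian θ⟩

lemma map_dual_stdGaussian (L : StrongDual ℝ E) (hL : ‖L‖ = 1) :
    (stdGaussian E).map L = gaussianReal 0 1 := by
  rw [IsGaussian.map_eq_gaussianReal, variance_dual_stdGaussian, integral_strongDual_stdGaussian, hL]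
  simp

lemma measurePreserving_skew_rotation (ν : Measure ℝ) [SFinite ν] :
    MeasurePreserving (fun x : ℝ × (E × E) => (x.1, ContinuousLinearMap.rotation x.1 x.2))
      (ν.prod ((stdGaussian E).prod (stdGaussian E)))
      (ν.prod ((stdGaussian E).prod (stdGaussian E))) := by
  refine (MeasurePreserving.id ν).skew_product
    (g := fun θ x => ContinuousLinearMap.rotation θ x) ?_
    (ae_of_all _ fun θ => map_rotation_stdGaussian θ)
  simp only [Function.uncurry_def, ContinuousLinearMap.rotation_apply]
  exact Continuous.measurable (by fun_prop)

end InnerProduct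

/-- Properties of the distance function to a closed convex cone. -/
structure IsConeDist {E : Type*} [NormedAddCommGroup E] [NormedSpace ℝ E] (q : E → ℝ) : Prop where
  nonneg : ∀ h, 0 ≤ q h
  smul : ∀ c : ℝ, 0 ≤ c → ∀ h, q (c • h) = c * q h
  add_le : ∀ h k, q (h + k) ≤ q h + q k
  le_norm : ∀ h, q h ≤ ‖h‖
  exists_zero : ∀ h, ∀ η > 0, ∃ v, ‖v‖ ≤ q h + η ∧ q (h - v) = 0

/-- The partial infimum of `q` along the range of `T`. -/
def infRange {E F : Type*} [NormedAddCommGroup E] [NormedSpace ℝ E] [AddCommGroup F] [Module ℝ F]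
    (q : E → ℝ) (T : F →ₗ[ℝ] E) (h : E) : ℝ := ⨅ c : F, q (h - T c)

namespace IsConeDist

section Basic

variable {E : Type*} [NormedAddCommGroup E] [NormedSpace ℝ E] {q : E → ℝ}

lemma zero (hq : IsConeDist q) : q 0 = 0 := by simpa using hq.smul 0 le_rfl 0

lemma abs_sub_le (hq : IsConeDist q) (h k : E) : |q h - q k| ≤ ‖h - k‖ := by
  have h1 := hq.add_le k (h - k)
  have h2 := hq.add_le h (k - h)
  have h3 := hq.le_norm (h - k)
  have h4 := hq.le_norm (k - h)
  rw [norm_sub_rev] at h4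
  rw [add_sub_cancel] at h1 h2
  rw [abs_le]; constructor <;> linarith

lemma lipschitzWith (hq : IsConeDist q) : LipschitzWith 1 q :=
  LipschitzWith.of_dist_le_mul fun h k => by
    simpa [Real.dist_eq, dist_eq_norm] using hq.abs_sub_le h k

lemma continuous (hq : IsConeDist q) : Continuous q := hq.lipschitzWith.continuous

lemma fderiv_eq_zero (hq : IsConeDist q) {h : E} (h0 : q h = 0) : fderiv ℝ q h = 0 :=
  IsLocalMin.fderiv_eq_zero (Eventually.of_forall fun k => h0 ▸ hq.nonneg k)

lemma norm_fderiv (hq : IsConeDist q) {h : E} (h0 : 0 < q h) (hd : DifferentiableAt ℝ q h) :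
    ‖fderiv ℝ q h‖ = 1 := by
  refine le_antisymm (by simpa using norm_fderiv_le_of_lipschitz ℝ hq.lipschitzWith) ?_
  have key : ∀ η > 0, q h ≤ ‖fderiv ℝ q h‖ * (q h + η) := by
    intro η hη
    obtain ⟨v, hv, hv0⟩ := hq.exists_zero h η hη
    have hline : HasDerivAt (fun s : ℝ => q (h - s • v)) (-(fderiv ℝ q h v)) 0 := by
      have h1 : HasDerivAt (fun s : ℝ => h - s • v) (-v) 0 := by
        simpa using ((hasDerivAt_id (0 : ℝ)).smul_const v).const_sub h
      have h2 : HasFDerivAt q (fderiv ℝ q h) (h - (0 : ℝ) • v) := by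
        simpa using hd.hasFDerivAt
      have h3 := h2.comp_hasDerivAt (0 : ℝ) h1
      rw [map_neg] at h3
      exact h3
    have hslope := hline.hasDerivWithinAt (s := Set.Ioi 0)
    rw [hasDerivWithinAt_iff_tendsto_slope' (by simp)] at hslope
    have hle : -(fderiv ℝ q h v) ≤ -q h := by
      refine le_of_tendsto hslope ?_
      filter_upwards [Ioo_mem_nhdsGT (zero_lt_one' ℝ)] with s hs
      have e : h - s • v = (1 - s) • h + s • (h - v) := by module
      have hb := hq.add_le ((1 - s) • h) (s • (h - v))
      rw [← e, hq.smul _ (by linarith [hs.2]), hq.smul _ hs.1.le, hv0] at hb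
      rw [slope_def_field, sub_zero, div_le_iff₀ hs.1]
      simp only [zero_smul, sub_zero]
      linarith
    calc q h ≤ fderiv ℝ q h v := by linarith
      _ ≤ ‖fderiv ℝ q h‖ * ‖v‖ := (le_abs_self _).trans ((fderiv ℝ q h).le_opNorm v)
      _ ≤ _ := by gcongr
  have : q h ≤ ‖fderiv ℝ q h‖ * q h := by
    have ht : Tendsto (fun η : ℝ => ‖fderiv ℝ q h‖ * (q h + η)) (𝓝[>] 0)
        (𝓝 (‖fderiv ℝ q h‖ * (q h + 0))) :=
      (Continuous.tendsto (by fun_prop) 0).mono_left nhdsWithin_le_nhds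
    rw [add_zero] at ht
    exact ge_of_tendsto ht (eventually_mem_nhdsWithin.mono fun η hη => key η hη)
  exact le_of_mul_le_mul_right (by linarith) h0

variable {F : Type*} [AddCommGroup F] [Module ℝ F] (T : F →ₗ[ℝ] E)

lemma bddBelow (hq : IsConeDist q) (h : E) : BddBelow (Set.range fun c : F => q (h - T c)) :=
  ⟨0, by rintro _ ⟨c, rfl⟩; exact hq.nonneg _⟩

lemma infRange_le (hq : IsConeDist q) (h : E) (c : F) : infRange q T h ≤ q (h - T c) :=
  ciInf_le (hq.bddBelow T h) c

lemma infRange (hq : IsConeDist q) : IsConeDist (infRange q T) where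
  nonneg h := Real.iInf_nonneg fun c => hq.nonneg _
  smul := by
    have key : ∀ c : ℝ, 0 < c → ∀ h, _root_.infRange q T (c • h) ≤ c * _root_.infRange q T h := by
      intro c hc h
      rw [_root_.infRange, _root_.infRange, Real.mul_iInf_of_nonneg hc.le]
      refine le_ciInf fun a => (hq.infRange_le T (c • h) (c • a)).trans_eq ?_
      rw [map_smul, ← smul_sub, hq.smul _ hc.le]
    intro c hc h
    rcases hc.eq_or_lt with rfl | hc
    · rw [zero_smul, zero_mul]
      refine le_antisymm ((hq.infRange_le T 0 0).trans_eq (by simp [hq.zero]))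
        (Real.iInf_nonneg fun c => hq.nonneg _)
    · refine le_antisymm (key c hc h) ?_
      have := key c⁻¹ (inv_pos.2 hc) (c • h)
      rw [inv_smul_smul₀ hc.ne', inv_mul_eq_div, le_div_iff₀ hc] at this
      linarith
  add_le h k := by
    refine le_ciInf_add_ciInf fun a b => (hq.infRange_le T (h + k) (a + b)).trans ?_
    rw [map_add, add_sub_add_comm]
    exact hq.add_le _ _
  le_norm h := (hq.infRange_le T h 0).trans (by simpa using hq.le_norm h)
  exists_zero h η hη := by
    obtain ⟨c, hc⟩ := exists_lt_of_ciInf_lt (show ⨅ c : F, q (h - T c) < _root_.infRange q T h + η / 2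
      by rw [← _root_.infRange]; linarith)
    obtain ⟨v, hv, hv0⟩ := hq.exists_zero (h - T c) (η / 2) (by linarith)
    refine ⟨v, by linarith, le_antisymm ((hq.infRange_le T _ c).trans_eq ?_)
      (Real.iInf_nonneg fun c => hq.nonneg _)⟩
    rw [← hv0]; congr 1; abel

lemma upperSemicontinuous_infRange (hq : IsConeDist q) :
    UpperSemicontinuous fun x : E × E => _root_.infRange q (LinearMap.toSpanSingleton ℝ E x.2) x.1 := by
  refine upperSemicontinuous_ciInf (fun x => hq.bddBelow _ _) fun t => ?_
  simp only [LinearMap.toSpanSingleton_apply]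
  exact (hq.continuous.comp (by fun_prop)).upperSemicontinuous

end Basic

end IsConeDist

lemma one_sub_cos_le_mul_sin {d : ℝ} (hd : 0 < d) (hd1 : d ≤ 1) :
    1 - Real.cos d ≤ d * Real.sin d := by
  have h1 := Real.one_sub_sq_div_two_le_cos (x := d)
  have h2 := Real.sin_gt_sub_cube hd
  nlinarith [mul_pos hd hd, mul_pos (mul_pos hd hd) hd]

namespace IsConeDist

variable {E : Type*} [NormedAddCommGroup E] [InnerProductSpace ℝ E] {q : E → ℝ}

/-- The section of a cone distance along the unit circle spanned by a pair, shifted by `ε`. -/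
def circle (q : E → ℝ) (ε : ℝ) (x : E × E) (θ : ℝ) : ℝ :=
  q (Real.cos θ • x.1 + Real.sin θ • x.2) + ε

lemma circle_rotation (q : E → ℝ) (ε : ℝ) (x : E × E) (φ θ : ℝ) :
    circle q ε (ContinuousLinearMap.rotation φ x) θ = circle q ε x (φ + θ) := by
  simp only [circle, ContinuousLinearMap.rotation_apply, Real.cos_add, Real.sin_add]
  congr 2
  module

lemma continuous_circle (hq : IsConeDist q) (ε : ℝ) (x : E × E) :
    Continuous fun θ => circle q ε x θ := by
  have := hq.continuous
  unfold circle
  fun_prop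

lemma circle_zero (q : E → ℝ) (ε : ℝ) (x : E × E) : circle q ε x 0 = q x.1 + ε := by
  simp [circle]

/-- The partial infimum along the second vector of a pair. -/
def pairInf (q : E → ℝ) (x : E × E) : ℝ := _root_.infRange q (LinearMap.toSpanSingleton ℝ E x.2) x.1

lemma pairInf_nonneg (hq : IsConeDist q) (x : E × E) : 0 ≤ pairInf q x :=
  (hq.infRange _).nonneg _

lemma pairInf_le (hq : IsConeDist q) (x : E × E) (t : ℝ) : pairInf q x ≤ q (x.1 - t • x.2) := by
  simpa [pairInf] using hq.infRange_le (LinearMap.toSpanSingleton ℝ E x.2) x.1 t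

lemma circle_three_term (hq : IsConeDist q) {d : ℝ} (hd : 0 ≤ d) (hcos : 0 ≤ Real.cos d)
    (x : E × E) (θ : ℝ) :
    2 * Real.cos d * circle q d x θ ≤ circle q d x (θ - d) + circle q d x (θ + d) := by
  have e : (2 * Real.cos d) • (Real.cos θ • x.1 + Real.sin θ • x.2) =
      (Real.cos (θ - d) • x.1 + Real.sin (θ - d) • x.2) +
        (Real.cos (θ + d) • x.1 + Real.sin (θ + d) • x.2) := by
    rw [Real.cos_sub, Real.cos_add, Real.sin_sub, Real.sin_add]
    module
  have := hq.add_le (Real.cos (θ - d) • x.1 + Real.sin (θ - d) • x.2)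
    (Real.cos (θ + d) • x.1 + Real.sin (θ + d) • x.2)
  rw [← e, hq.smul _ (by positivity)] at this
  simp only [circle]
  nlinarith [Real.cos_le_one d]

lemma pairInf_rotation_mul_cos_le (hq : IsConeDist q) {d : ℝ} (hd : 0 ≤ d) (x : E × E) (θ ψ : ℝ)
    (h : 0 < Real.cos (ψ - θ)) :
    pairInf q (ContinuousLinearMap.rotation θ x) * Real.cos (ψ - θ) ≤ circle q d x ψ := by
  have h1 := hq.pairInf_le (ContinuousLinearMap.rotation θ x) (-Real.tan (ψ - θ))
  have e : Real.cos (ψ - θ) • ((ContinuousLinearMap.rotation θ x).1 -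
      (-Real.tan (ψ - θ)) • (ContinuousLinearMap.rotation θ x).2) =
      Real.cos ψ • x.1 + Real.sin ψ • x.2 := by
    rw [neg_smul, sub_neg_eq_add, smul_add, smul_smul, mul_comm,
      Real.tan_mul_cos h.ne']
    simp only [ContinuousLinearMap.rotation_apply]
    have hc : Real.cos ψ = Real.cos (θ + (ψ - θ)) := by ring_nf
    have hs : Real.sin ψ = Real.sin (θ + (ψ - θ)) := by ring_nf
    rw [hc, hs, Real.cos_add, Real.sin_add]
    module
  calc pairInf q (ContinuousLinearMap.rotation θ x) * Real.cos (ψ - θ)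
      ≤ Real.cos (ψ - θ) * q ((ContinuousLinearMap.rotation θ x).1 -
      (-Real.tan (ψ - θ)) • (ContinuousLinearMap.rotation θ x).2) := by
        rw [mul_comm]; gcongr
    _ = q (Real.cos ψ • x.1 + Real.sin ψ • x.2) := by rw [← hq.smul _ h.le, e]
    _ ≤ circle q d x ψ := by simp only [circle]; linarith

lemma continuous_rotation :
    Continuous fun y : ℝ × (E × E) => ContinuousLinearMap.rotation y.1 y.2 := by
  simp only [ContinuousLinearMap.rotation_apply]
  fun_prop

variable [FiniteDimensional ℝ E] [MeasurableSpace E] [BorelSpace E]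

lemma measurable_pairInf (hq : IsConeDist q) : Measurable (pairInf q) :=
  hq.upperSemicontinuous_infRange.measurable

lemma mul_integral_circle_le (hq : IsConeDist q) {l d : ℝ} (hl : 0 ≤ l) (hd : 0 < d) (hd1 : d ≤ 1)
    (x : E × E) :
    d * ∫ θ in (0 : ℝ)..2 * Real.pi,
        sqExpSq l (pairInf q (ContinuousLinearMap.rotation θ x)) ≤
      ∫ θ in (0 : ℝ)..2 * Real.pi, mulExpSq l (circle q d x θ) *
        (expSqPrimitive l ((circle q d x (θ + d) - circle q d x θ * Real.cos d) / Real.sin d) -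
         expSqPrimitive l ((circle q d x θ * Real.cos d - circle q d x (θ - d)) / Real.sin d)) := by
  have hdpi : d < Real.pi / 2 := by linarith [Real.pi_gt_three]
  have hcos : 0 < Real.cos d := Real.cos_pos_of_mem_Ioo ⟨by linarith, hdpi⟩
  have hc : Continuous fun θ : ℝ => ((θ, x) : ℝ × (E × E)) := by fun_prop
  have hf : Continuous fun θ => circle q d x θ := hq.continuous_circle d x
  have hu : Measurable fun θ => pairInf q (ContinuousLinearMap.rotation θ x) :=
    hq.measurable_pairInf.comp (continuous_rotation.comp hc).measurable
  have h1 : Function.Periodic (fun θ => circle q d x θ) (2 * Real.pi) := fun θ => by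
    simp only [circle, Real.cos_add_two_pi, Real.sin_add_two_pi]
  have h2 : Function.Periodic (fun θ => pairInf q (ContinuousLinearMap.rotation θ x)) (2 * Real.pi) := fun θ => by
    simp only [ContinuousLinearMap.rotation_apply, Real.cos_add_two_pi, Real.sin_add_two_pi]
  have h3 : ∀ θ, 0 < circle q d x θ := fun θ => add_pos_of_nonneg_of_pos (hq.nonneg _) hd
  exact mul_integral_sqExpSq_le hl hd hdpi hf h3 h1
    (hq.circle_three_term hd.le hcos.le x) hu (fun θ => hq.pairInf_nonneg _)
    h2 (hq.pairInf_rotation_mul_cos_le hd.le x)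

/-- Averaging over rotations of a pair of independent standard Gaussian vectors. -/
lemma _root_.integral_rotation_average {Φ : E × E → ℝ}
    (hΦ : Integrable Φ ((stdGaussian E).prod (stdGaussian E))) :
    Integrable (fun x => ∫ θ in (0 : ℝ)..2 * Real.pi, Φ (ContinuousLinearMap.rotation θ x))
        ((stdGaussian E).prod (stdGaussian E)) ∧
      ∫ x, (∫ θ in (0 : ℝ)..2 * Real.pi, Φ (ContinuousLinearMap.rotation θ x))
        ∂((stdGaussian E).prod (stdGaussian E)) =
      2 * Real.pi * ∫ x, Φ x ∂((stdGaussian E).prod (stdGaussian E)) := by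
  have hpi : (0 : ℝ) ≤ 2 * Real.pi := by positivity
  set P := (stdGaussian E).prod (stdGaussian E)
  set ν := (volume : Measure ℝ).restrict (Set.Ioc 0 (2 * Real.pi))
  have hmp := measurePreserving_skew_rotation (E := E) ν
  have h1 : Integrable (fun y : ℝ × (E × E) => Φ y.2) (ν.prod P) := hΦ.comp_snd ν
  have h2 : Integrable (fun y : ℝ × (E × E) => Φ (ContinuousLinearMap.rotation y.1 y.2))
      (ν.prod P) := (hmp.integrable_comp h1.aestronglyMeasurable).2 h1
  simp only [intervalIntegral.integral_of_le hpi]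
  refine ⟨h2.integral_prod_right, ?_⟩
  rw [integral_integral_swap (f := fun x θ => Φ (ContinuousLinearMap.rotation θ x)) h2.swap]
  have h3 : ∀ θ, ∫ x, Φ (ContinuousLinearMap.rotation θ x) ∂P = ∫ x, Φ x ∂P := fun θ => by
    have := integral_map (μ := P) (φ := fun x => ContinuousLinearMap.rotation θ x) (f := Φ)
      (measurePreserving_rotation θ).measurable.aemeasurable
      (by rw [(measurePreserving_rotation θ).map_eq]; exact hΦ.aestronglyMeasurable)
    rw [← this, (measurePreserving_rotation θ).map_eq]
  simp only [h3, integral_const, smul_eq_mul]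
  simp [ν, measureReal_def, Real.pi_pos.le]

end IsConeDist

lemma abs_mulExpSq_le {l a R : ℝ} (hl : 0 ≤ l) (ha : |a| ≤ R) :
    |mulExpSq l a| ≤ R * Real.exp (l * R ^ 2) := by
  have : a ^ 2 ≤ R ^ 2 := sq_le_sq' (abs_le.1 ha).1 (abs_le.1 ha).2
  rw [mulExpSq, abs_mul, Real.abs_exp]
  have hR := (abs_nonneg a).trans ha
  gcongr

lemma abs_mulExpSq_sub_le {l : ℝ} (hl : 0 ≤ l) {a b R : ℝ} (ha : |a| ≤ R) (hb : |b| ≤ R) :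
    |mulExpSq l b - mulExpSq l a| ≤ Real.exp (3 * l * R ^ 2) * |b - a| := by
  have := (convex_Icc (-R) R).norm_image_sub_le_of_norm_hasDerivWithin_le (f := mulExpSq l)
    (f' := fun x => (1 + 2 * l * x ^ 2) * Real.exp (l * x ^ 2)) (C := Real.exp (3 * l * R ^ 2))
    (x := a) (y := b)
    (fun x _ => (hasStrictDerivAt_mulExpSq l x).hasDerivAt.hasDerivWithinAt)
    (fun x hx => by
      have hx2 : x ^ 2 ≤ R ^ 2 := sq_le_sq' hx.1 hx.2
      rw [Real.norm_of_nonneg (by positivity)]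
      calc (1 + 2 * l * x ^ 2) * Real.exp (l * x ^ 2)
          ≤ Real.exp (2 * l * x ^ 2) * Real.exp (l * x ^ 2) := by
            gcongr; linarith [Real.add_one_le_exp (2 * l * x ^ 2)]
        _ = Real.exp (3 * l * x ^ 2) := by rw [← Real.exp_add]; ring_nf
        _ ≤ _ := by gcongr) (abs_le.1 ha) (abs_le.1 hb)
  simpa using this

section Increments

variable {l d f₀ f₁ R : ℝ}

lemma abs_increment_bounds (hd : 0 < d) (hd1 : d ≤ 1) (h0 : 0 ≤ f₀) (h0R : f₀ ≤ R)
    (h1 : 0 ≤ f₁) (h1R : f₁ ≤ R) (h01 : |f₁ - f₀| ≤ Real.sin d * R) :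
    |(f₁ - f₀ * Real.cos d) / Real.sin d| ≤ 2 * R ∧
    |(f₁ * Real.cos d - f₀) / Real.sin d| ≤ 2 * R ∧
    |(f₁ - f₀ * Real.cos d) / Real.sin d - (f₁ * Real.cos d - f₀) / Real.sin d| ≤ 2 * R * d := by
  have hsin : 0 < Real.sin d := Real.sin_pos_of_pos_of_lt_pi hd (by linarith [Real.pi_gt_three])
  have hc := one_sub_cos_le_mul_sin hd hd1
  have hc0 := Real.cos_le_one d
  have hds : 0 ≤ Real.sin d * R := mul_nonneg hsin.le (h0.trans h0R)
  have hd0 : 0 ≤ (1 - d) * Real.sin d := mul_nonneg (by linarith) hsin.le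
  rw [abs_le] at h01
  refine ⟨?_, ?_, ?_⟩
  · rw [abs_div, abs_of_pos hsin, div_le_iff₀ hsin, abs_le]
    constructor <;> nlinarith
  · rw [abs_div, abs_of_pos hsin, div_le_iff₀ hsin, abs_le]
    constructor <;> nlinarith
  · rw [← sub_div, abs_div, abs_of_pos hsin, div_le_iff₀ hsin, abs_le]
    constructor <;> nlinarith

lemma abs_increment_terms_le (hl : 0 ≤ l) (hd : 0 < d) (hd1 : d ≤ 1) (h0 : 0 ≤ f₀) (h0R : f₀ ≤ R)
    (h1 : 0 ≤ f₁) (h1R : f₁ ≤ R) (h01 : |f₁ - f₀| ≤ Real.sin d * R) :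
    |mulExpSq l f₀ * expSqPrimitive l ((f₁ - f₀ * Real.cos d) / Real.sin d)| ≤
      4 * R ^ 2 * Real.exp (7 * l * R ^ 2) ∧
    |mulExpSq l f₁ * expSqPrimitive l ((f₁ * Real.cos d - f₀) / Real.sin d)| ≤
      4 * R ^ 2 * Real.exp (7 * l * R ^ 2) ∧
    |mulExpSq l f₀ * expSqPrimitive l ((f₁ - f₀ * Real.cos d) / Real.sin d) -
      mulExpSq l f₁ * expSqPrimitive l ((f₁ * Real.cos d - f₀) / Real.sin d)| ≤
      d * (4 * R ^ 2 * Real.exp (7 * l * R ^ 2)) := by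
  obtain ⟨hb, hb', hbb⟩ := abs_increment_bounds hd hd1 h0 h0R h1 h1R h01
  set b := (f₁ - f₀ * Real.cos d) / Real.sin d
  set b' := (f₁ * Real.cos d - f₀) / Real.sin d
  have hR : 0 ≤ R := h0.trans h0R
  have hA0 := abs_mulExpSq_le hl (by rwa [abs_of_nonneg h0] : |f₀| ≤ R)
  have hA1 := abs_mulExpSq_le hl (by rwa [abs_of_nonneg h1] : |f₁| ≤ R)
  have hK := abs_expSqPrimitive_le hl hb
  have hK' := abs_expSqPrimitive_le hl hb'
  have hKK := abs_expSqPrimitive_sub_le hl hb' hb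
  have hAA := abs_mulExpSq_sub_le hl (by rwa [abs_of_nonneg h1] : |f₁| ≤ R)
    (by rwa [abs_of_nonneg h0] : |f₀| ≤ R)
  have hsd : |f₀ - f₁| ≤ d * R := by
    rw [abs_sub_comm]
    exact h01.trans (by gcongr; exact Real.sin_le hd.le)
  have e5 : Real.exp (l * R ^ 2) * Real.exp (l * (2 * R) ^ 2) ≤ Real.exp (7 * l * R ^ 2) := by
    rw [← Real.exp_add]
    exact Real.exp_le_exp.2 (by nlinarith [mul_nonneg hl (sq_nonneg R)])
  have e7 : Real.exp (3 * l * R ^ 2) * Real.exp (l * (2 * R) ^ 2) = Real.exp (7 * l * R ^ 2) := by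
    rw [← Real.exp_add]; ring_nf
  refine ⟨?_, ?_, ?_⟩
  · rw [abs_mul]
    calc _ ≤ (R * Real.exp (l * R ^ 2)) * (Real.exp (l * (2 * R) ^ 2) * (2 * R)) := by gcongr
      _ = 2 * R ^ 2 * (Real.exp (l * R ^ 2) * Real.exp (l * (2 * R) ^ 2)) := by ring
      _ ≤ 4 * R ^ 2 * Real.exp (7 * l * R ^ 2) := by gcongr; norm_num
  · rw [abs_mul]
    calc _ ≤ (R * Real.exp (l * R ^ 2)) * (Real.exp (l * (2 * R) ^ 2) * (2 * R)) := by gcongr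
      _ = 2 * R ^ 2 * (Real.exp (l * R ^ 2) * Real.exp (l * (2 * R) ^ 2)) := by ring
      _ ≤ 4 * R ^ 2 * Real.exp (7 * l * R ^ 2) := by gcongr; norm_num
  · have e : mulExpSq l f₀ * expSqPrimitive l b - mulExpSq l f₁ * expSqPrimitive l b' =
        mulExpSq l f₀ * (expSqPrimitive l b - expSqPrimitive l b') +
          (mulExpSq l f₀ - mulExpSq l f₁) * expSqPrimitive l b' := by ring
    rw [e]
    refine (abs_add_le _ _).trans ?_
    rw [abs_mul, abs_mul]
    calc _ ≤ (R * Real.exp (l * R ^ 2)) * (Real.exp (l * (2 * R) ^ 2) * (2 * R * d)) +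
          (Real.exp (3 * l * R ^ 2) * (d * R)) * (Real.exp (l * (2 * R) ^ 2) * (2 * R)) := by
          gcongr
          · exact hKK.trans (by gcongr)
          · exact hAA.trans (by gcongr)
      _ = 2 * d * R ^ 2 * (Real.exp (l * R ^ 2) * Real.exp (l * (2 * R) ^ 2)) +
          2 * d * R ^ 2 * (Real.exp (3 * l * R ^ 2) * Real.exp (l * (2 * R) ^ 2)) := by ring
      _ ≤ 2 * d * R ^ 2 * Real.exp (7 * l * R ^ 2) + 2 * d * R ^ 2 * Real.exp (7 * l * R ^ 2) := by
          rw [e7]; gcongr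
      _ = _ := by ring

end Increments

section InnerProduct

variable {E : Type*} [NormedAddCommGroup E] [InnerProductSpace ℝ E] [FiniteDimensional ℝ E]
  [MeasurableSpace E] [BorelSpace E]

lemma integrable_exp_radius {c : ℝ} (hc0 : 0 ≤ c) (hc : 6 * c < 1) :
    Integrable (fun x : E × E => Real.exp (c * (1 + ‖x.1‖ + ‖x.2‖) ^ 2))
      ((stdGaussian E).prod (stdGaussian E)) := by
  have h := integrable_exp_mul_norm_sq_stdGaussian (E := E) (c := 3 * c) (by linarith)
  refine ((h.mul_prod h).const_mul (Real.exp (3 * c))).mono' (by fun_prop)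
    (ae_of_all _ fun x => ?_)
  rw [Real.norm_of_nonneg (by positivity), ← Real.exp_add, ← Real.exp_add, Real.exp_le_exp]
  nlinarith [mul_nonneg hc0 (sq_nonneg (1 - ‖x.1‖)), mul_nonneg hc0 (sq_nonneg (1 - ‖x.2‖)),
    mul_nonneg hc0 (sq_nonneg (‖x.1‖ - ‖x.2‖))]

lemma integrable_sq_mul_exp_radius {l : ℝ} (hl : 0 < l) (hl' : l ≤ 1 / 100) :
    Integrable (fun x : E × E => 4 * (1 + ‖x.1‖ + ‖x.2‖) ^ 2 *
      Real.exp (7 * l * (1 + ‖x.1‖ + ‖x.2‖) ^ 2)) ((stdGaussian E).prod (stdGaussian E)) := by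
  refine ((integrable_exp_radius (c := 8 * l) (by positivity) (by linarith)).const_mul
    (4 * (8 * l - 7 * l)⁻¹)).mono' (by fun_prop) (ae_of_all _ fun x => ?_)
  rw [Real.norm_of_nonneg (by positivity)]
  have := sq_mul_exp_le (l := 7 * l) (c := 8 * l) (x := 1 + ‖x.1‖ + ‖x.2‖) (by linarith)
  nlinarith

end InnerProduct

namespace IsConeDist

variable {E : Type*} [NormedAddCommGroup E] [InnerProductSpace ℝ E] {q : E → ℝ}

/-- The forward term of the increment comparison. -/
def forwardTerm (q : E → ℝ) (l d : ℝ) (x : E × E) : ℝ :=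
  mulExpSq l (circle q d x 0) *
    expSqPrimitive l ((circle q d x d - circle q d x 0 * Real.cos d) / Real.sin d)

/-- The backward term of the increment comparison. -/
def backwardTerm (q : E → ℝ) (l d : ℝ) (x : E × E) : ℝ :=
  mulExpSq l (circle q d x d) *
    expSqPrimitive l ((circle q d x d * Real.cos d - circle q d x 0) / Real.sin d)

lemma circle_nonneg (hq : IsConeDist q) {d : ℝ} (hd : 0 ≤ d) (x : E × E) (θ : ℝ) :
    0 ≤ circle q d x θ := add_nonneg (hq.nonneg _) hd

lemma circle_le (hq : IsConeDist q) {d : ℝ} (hd1 : d ≤ 1) (x : E × E) (θ : ℝ) :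
    circle q d x θ ≤ 1 + ‖x.1‖ + ‖x.2‖ := by
  have h1 := hq.le_norm (Real.cos θ • x.1 + Real.sin θ • x.2)
  have h2 := norm_add_le (Real.cos θ • x.1) (Real.sin θ • x.2)
  rw [norm_smul, norm_smul, Real.norm_eq_abs, Real.norm_eq_abs] at h2
  have h3 := mul_le_mul_of_nonneg_right (Real.abs_cos_le_one θ) (norm_nonneg x.1)
  have h4 := mul_le_mul_of_nonneg_right (Real.abs_sin_le_one θ) (norm_nonneg x.2)
  simp only [circle]
  linarith

lemma abs_circle_sub_le (hq : IsConeDist q) {d : ℝ} (hd : 0 < d) (hd1 : d ≤ 1) (x : E × E) :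
    |circle q d x d - circle q d x 0| ≤ Real.sin d * (1 + ‖x.1‖ + ‖x.2‖) := by
  have hsin : 0 < Real.sin d := Real.sin_pos_of_pos_of_lt_pi hd (by linarith [Real.pi_gt_three])
  have hc := one_sub_cos_le_mul_sin hd hd1
  rw [circle_zero, circle, add_sub_add_right_eq_sub]
  refine (hq.abs_sub_le _ _).trans ?_
  have e : Real.cos d • x.1 + Real.sin d • x.2 - x.1 =
      (Real.cos d - 1) • x.1 + Real.sin d • x.2 := by module
  rw [e]
  refine (norm_add_le _ _).trans ?_
  rw [norm_smul, norm_smul, Real.norm_of_nonneg hsin.le, Real.norm_eq_abs,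
    abs_of_nonpos (by linarith [Real.cos_le_one d])]
  have : 1 - Real.cos d ≤ Real.sin d := hc.trans (mul_le_of_le_one_left hsin.le hd1)
  nlinarith [norm_nonneg x.1, norm_nonneg x.2]

lemma abs_terms_le (hq : IsConeDist q) {l d : ℝ} (hl : 0 ≤ l) (hd : 0 < d) (hd1 : d ≤ 1)
    (x : E × E) :
    |forwardTerm q l d x| ≤
      4 * (1 + ‖x.1‖ + ‖x.2‖) ^ 2 * Real.exp (7 * l * (1 + ‖x.1‖ + ‖x.2‖) ^ 2) ∧
    |backwardTerm q l d x| ≤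
      4 * (1 + ‖x.1‖ + ‖x.2‖) ^ 2 * Real.exp (7 * l * (1 + ‖x.1‖ + ‖x.2‖) ^ 2) ∧
    |forwardTerm q l d x - backwardTerm q l d x| ≤
      d * (4 * (1 + ‖x.1‖ + ‖x.2‖) ^ 2 * Real.exp (7 * l * (1 + ‖x.1‖ + ‖x.2‖) ^ 2)) :=
  abs_increment_terms_le hl hd hd1 (hq.circle_nonneg hd.le x 0) (hq.circle_le hd1 x 0)
    (hq.circle_nonneg hd.le x d) (hq.circle_le hd1 x d) (hq.abs_circle_sub_le hd hd1 x)

lemma continuous_circle_right (hq : IsConeDist q) (ε θ : ℝ) :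
    Continuous fun x : E × E => circle q ε x θ := by
  have := hq.continuous
  unfold circle
  fun_prop

lemma continuous_forwardTerm (hq : IsConeDist q) (l d : ℝ) :
    Continuous (forwardTerm q l d) := by
  have h0 := hq.continuous_circle_right d 0
  have h1 := hq.continuous_circle_right d d
  exact ((continuous_mulExpSq l).comp h0).mul ((continuous_expSqPrimitive l).comp
    ((h1.sub (h0.mul continuous_const)).div_const _))

lemma continuous_backwardTerm (hq : IsConeDist q) (l d : ℝ) :
    Continuous (backwardTerm q l d) := by
  have h0 := hq.continuous_circle_right d 0
  have h1 := hq.continuous_circle_right d d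
  exact ((continuous_mulExpSq l).comp h1).mul ((continuous_expSqPrimitive l).comp
    (((h1.mul continuous_const).sub h0).div_const _))

/-- The pointwise limit of the increment comparison. -/
def limitTerm (q : E → ℝ) (l : ℝ) (x : E × E) : ℝ :=
  mulExpSq l (q x.1) * q x.1 * Real.exp (l * (fderiv ℝ q x.1 x.2) ^ 2) -
    (1 + 2 * l * q x.1 ^ 2) * Real.exp (l * q x.1 ^ 2) *
      (fderiv ℝ q x.1 x.2 * expSqPrimitive l (fderiv ℝ q x.1 x.2))

lemma tendsto_circle_div (hx : E × E) (hd : DifferentiableAt ℝ q hx.1) :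
    Tendsto (fun d : ℝ => (circle q d hx d - circle q d hx 0) / d) (𝓝[>] 0)
      (𝓝 (fderiv ℝ q hx.1 hx.2)) := by
  have h1 : HasDerivAt (fun s : ℝ => Real.cos s • hx.1 + Real.sin s • hx.2) hx.2 0 := by
    have h := ((Real.hasDerivAt_cos 0).smul_const hx.1).add
      ((Real.hasDerivAt_sin 0).smul_const hx.2)
    rw [Real.sin_zero, Real.cos_zero, neg_zero, zero_smul, zero_add, one_smul] at h
    exact h
  have h2 : HasFDerivAt q (fderiv ℝ q hx.1)
      (Real.cos (0 : ℝ) • hx.1 + Real.sin (0 : ℝ) • hx.2) := by simpa using hd.hasFDerivAt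
  have h3 := (h2.comp_hasDerivAt (0 : ℝ) h1).hasDerivWithinAt (s := Set.Ioi 0)
  rw [hasDerivWithinAt_iff_tendsto_slope' (by simp)] at h3
  refine h3.congr fun d => ?_
  simp [slope_def_field, circle, Function.comp]

lemma tendsto_term_div {l : ℝ} (x : E × E) (hd : DifferentiableAt ℝ q x.1) :
    Tendsto (fun d : ℝ => (forwardTerm q l d x - backwardTerm q l d x) / d) (𝓝[>] 0)
      (𝓝 (limitTerm q l x)) := by
  set N := fderiv ℝ q x.1 x.2 with hN
  have hslope := tendsto_circle_div x hd
  rw [← hN] at hslope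
  have hid : Tendsto (fun d : ℝ => d) (𝓝[>] 0) (𝓝 0) := tendsto_id.mono_left nhdsWithin_le_nhds
  have hf0 : Tendsto (fun d : ℝ => circle q d x 0) (𝓝[>] 0) (𝓝 (q x.1)) := by
    simp only [circle_zero]
    simpa using hid.const_add (q x.1)
  have hf1 : Tendsto (fun d : ℝ => circle q d x d) (𝓝[>] 0) (𝓝 (q x.1)) := by
    have h := (hslope.mul hid).add hf0
    rw [mul_zero, zero_add] at h
    refine h.congr' (eventually_mem_nhdsWithin.mono fun d hd => ?_)
    rw [div_mul_cancel₀ _ (ne_of_gt hd)]; ring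
  have hsd : Tendsto (fun d : ℝ => Real.sin d / d) (𝓝[>] 0) (𝓝 1) := by
    have h3 := (Real.hasDerivAt_sin 0).hasDerivWithinAt (s := Set.Ioi 0)
    rw [hasDerivWithinAt_iff_tendsto_slope' (by simp), Real.cos_zero] at h3
    refine h3.congr fun d => ?_
    simp [slope_def_field]
  have hcd : Tendsto (fun d : ℝ => (1 - Real.cos d) / (d * Real.sin d)) (𝓝[>] 0)
      (𝓝 (1 / 2)) := by
    have h4 : Tendsto (fun d : ℝ => (1 + Real.cos d)⁻¹ * (Real.sin d / d)) (𝓝[>] 0)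
        (𝓝 ((1 + Real.cos 0)⁻¹ * 1)) := by
      refine Tendsto.mul ?_ hsd
      refine (ContinuousAt.tendsto ?_).mono_left nhdsWithin_le_nhds
      exact ContinuousAt.inv₀ (by fun_prop) (by simp)
    have e2 : (1 + Real.cos 0)⁻¹ * 1 = (1 / 2 : ℝ) := by rw [Real.cos_zero]; norm_num
    rw [e2] at h4
    refine h4.congr' ?_
    filter_upwards [Ioo_mem_nhdsGT (zero_lt_one' ℝ)] with d hd
    have hsin : 0 < Real.sin d :=
      Real.sin_pos_of_pos_of_lt_pi hd.1 (by linarith [Real.pi_gt_three, hd.2])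
    have hcos : 0 < Real.cos d := Real.cos_pos_of_mem_Ioo
      ⟨by linarith [Real.pi_gt_three, hd.1], by linarith [Real.pi_gt_three, hd.2]⟩
    have hd0 := hd.1
    have h2 := Real.sin_sq_add_cos_sq d
    field_simp
    nlinarith
  have hpos : ∀ᶠ d : ℝ in 𝓝[>] 0, 0 < d ∧ 0 < Real.sin d := by
    filter_upwards [Ioo_mem_nhdsGT (zero_lt_one' ℝ)] with d hd
    exact ⟨hd.1, Real.sin_pos_of_pos_of_lt_pi hd.1 (by linarith [Real.pi_gt_three, hd.2])⟩
  have hτ : Tendsto (fun d : ℝ => (1 - Real.cos d) / Real.sin d) (𝓝[>] 0) (𝓝 0) := by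
    have h := hcd.mul hid
    rw [mul_zero] at h
    refine h.congr' (hpos.mono fun d hd => ?_)
    have := hd.1; have := hd.2
    field_simp
  have hrat : Tendsto (fun d : ℝ => (circle q d x d - circle q d x 0) / Real.sin d) (𝓝[>] 0)
      (𝓝 N) := by
    have h := hslope.div hsd one_ne_zero
    rw [div_one] at h
    refine h.congr' (hpos.mono fun d hd => ?_)
    have := hd.1; have := hd.2
    simp only [Pi.div_apply]
    field_simp
  have hb : Tendsto (fun d : ℝ => (circle q d x d - circle q d x 0 * Real.cos d) / Real.sin d)
      (𝓝[>] 0) (𝓝 N) := by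
    have h := hrat.add (hf0.mul hτ)
    rw [mul_zero, add_zero] at h
    exact h.congr fun d => by ring
  have hb' : Tendsto (fun d : ℝ => (circle q d x d * Real.cos d - circle q d x 0) / Real.sin d)
      (𝓝[>] 0) (𝓝 N) := by
    have h := hrat.sub (hf1.mul hτ)
    rw [mul_zero, sub_zero] at h
    exact h.congr fun d => by ring
  have strict : ∀ {f : ℝ → ℝ} {f' a c : ℝ} {u v : ℝ → ℝ}, HasStrictDerivAt f f' a →
      Tendsto u (𝓝[>] 0) (𝓝 a) → Tendsto v (𝓝[>] 0) (𝓝 a) →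
      Tendsto (fun d => (u d - v d) / d) (𝓝[>] 0) (𝓝 c) →
      Tendsto (fun d => (f (u d) - f (v d)) / d) (𝓝[>] 0) (𝓝 (f' * c)) := by
    intro f f' a c u v hf hu hv huv
    have h1 := (hasStrictDerivAt_iff_hasStrictFDerivAt.1 hf).isLittleO.comp_tendsto (hu.prodMk_nhds hv)
    have h2 : (fun d => u d - v d) =O[𝓝[>] 0] fun d : ℝ => d := by
      refine Asymptotics.isBigO_of_div_tendsto_nhds ?_ c huv
      exact eventually_mem_nhdsWithin.mono fun d hd h0 => absurd h0 (ne_of_gt hd)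
    have h3 := (h1.trans_isBigO h2).tendsto_div_nhds_zero
    have h4 := h3.add (huv.const_mul f')
    rw [zero_add] at h4
    refine h4.congr fun d => ?_
    simp [Function.comp]; ring
  have hKK := strict (hasStrictDerivAt_expSqPrimitive l N) hb hb' (c := q x.1) (by
    have h := (hf0.add hf1).mul hcd
    have e : (q x.1 + q x.1) * (1 / 2) = q x.1 := by ring
    rw [e] at h
    refine h.congr' (hpos.mono fun d hd => ?_)
    have := hd.1; have := hd.2
    field_simp
    ring)
  have hAA := strict (hasStrictDerivAt_mulExpSq l (q x.1)) hf1 hf0 hslope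
  have hA0 := (continuous_mulExpSq l).continuousAt.tendsto.comp hf0
  have hK' := (continuous_expSqPrimitive l).continuousAt.tendsto.comp hb'
  have := (hA0.mul hKK).sub (hAA.mul hK')
  have e : mulExpSq l (q x.1) * (Real.exp (l * N ^ 2) * q x.1) -
      (1 + 2 * l * q x.1 ^ 2) * Real.exp (l * q x.1 ^ 2) * N * expSqPrimitive l N =
      limitTerm q l x := by rw [limitTerm, ← hN]; ring
  rw [e] at this
  refine this.congr fun d => ?_
  simp only [forwardTerm, backwardTerm, Function.comp]
  ring

end IsConeDist

namespace IsConeDist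

variable {E : Type*} [NormedAddCommGroup E] [InnerProductSpace ℝ E] [FiniteDimensional ℝ E]
  [MeasurableSpace E] [BorelSpace E] {q : E → ℝ} {l d : ℝ}

lemma integrable_sqExpSq_pairInf (hq : IsConeDist q) (hl : 0 < l) (hl' : l ≤ 1 / 100) :
    Integrable (fun x => sqExpSq l (pairInf q x)) ((stdGaussian E).prod (stdGaussian E)) := by
  refine (integrable_sq_mul_exp_radius (E := E) hl hl').mono'
    (((continuous_sqExpSq l).measurable.comp hq.measurable_pairInf).aestronglyMeasurable)
    (ae_of_all _ fun x => ?_)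
  rw [Real.norm_of_nonneg (sqExpSq_nonneg _ _)]
  have h1 : pairInf q x ≤ 1 + ‖x.1‖ + ‖x.2‖ := by
    have := (hq.pairInf_le x 0).trans (hq.le_norm _)
    simp only [zero_smul, sub_zero] at this
    linarith [norm_nonneg x.2]
  refine (sqExpSq_le_sqExpSq hl.le (hq.pairInf_nonneg x) h1).trans ?_
  rw [sqExpSq]
  have h2 : 0 ≤ l * (1 + ‖x.1‖ + ‖x.2‖) ^ 2 := by positivity
  gcongr ?_ * Real.exp ?_
  · nlinarith [sq_nonneg (1 + ‖x.1‖ + ‖x.2‖)]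
  · linarith

lemma integrable_forwardTerm (hq : IsConeDist q) (hl : 0 < l) (hl' : l ≤ 1 / 100) (hd : 0 < d)
    (hd1 : d ≤ 1) :
    Integrable (forwardTerm q l d) ((stdGaussian E).prod (stdGaussian E)) :=
  (integrable_sq_mul_exp_radius (E := E) hl hl').mono'
    (hq.continuous_forwardTerm l d).aestronglyMeasurable
    (ae_of_all _ fun x => (hq.abs_terms_le hl.le hd hd1 x).1)

lemma integrable_backwardTerm (hq : IsConeDist q) (hl : 0 < l) (hl' : l ≤ 1 / 100) (hd : 0 < d)
    (hd1 : d ≤ 1) :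
    Integrable (backwardTerm q l d) ((stdGaussian E).prod (stdGaussian E)) :=
  (integrable_sq_mul_exp_radius (E := E) hl hl').mono'
    (hq.continuous_backwardTerm l d).aestronglyMeasurable
    (ae_of_all _ fun x => (hq.abs_terms_le hl.le hd hd1 x).2.1)

lemma mul_integral_pairInf_le (hq : IsConeDist q) (hl : 0 < l) (hl' : l ≤ 1 / 100) (hd : 0 < d)
    (hd1 : d ≤ 1) :
    d * ∫ x, sqExpSq l (pairInf q x) ∂((stdGaussian E).prod (stdGaussian E)) ≤
      ∫ x, (forwardTerm q l d x - backwardTerm q l d x)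
        ∂((stdGaussian E).prod (stdGaussian E)) := by
  set P := (stdGaussian E).prod (stdGaussian E)
  let T : E × E → ℝ := fun x => mulExpSq l (circle q d x 0) *
    expSqPrimitive l ((circle q d x 0 * Real.cos d - circle q d x (-d)) / Real.sin d)
  have hTc : Continuous T := by
    have h0 := hq.continuous_circle_right d 0
    have h1 := hq.continuous_circle_right d (-d)
    exact ((continuous_mulExpSq l).comp h0).mul ((continuous_expSqPrimitive l).comp
      (((h0.mul continuous_const).sub h1).div_const _))
  have hTr : ∀ x, T (ContinuousLinearMap.rotation d x) = backwardTerm q l d x := fun x => by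
    simp only [T, backwardTerm, circle_rotation, add_zero, add_neg_cancel]
  have hF := hq.integrable_forwardTerm hl hl' hd hd1
  have hB := hq.integrable_backwardTerm hl hl' hd hd1
  have hmp := measurePreserving_rotation (E := E) d
  have hTi : Integrable T P := by
    rw [← hmp.integrable_comp hTc.aestronglyMeasurable]
    exact hB.congr (ae_of_all _ fun x => (hTr x).symm)
  have hTint : ∫ x, T x ∂P = ∫ x, backwardTerm q l d x ∂P := by
    have := integral_map (μ := P) (φ := fun x => ContinuousLinearMap.rotation d x) (f := T)
      hmp.measurable.aemeasurable hTc.aestronglyMeasurable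
    rw [hmp.map_eq] at this
    rw [this]
    exact integral_congr_ae (ae_of_all _ hTr)
  obtain ⟨i1, e1⟩ := integral_rotation_average (hq.integrable_sqExpSq_pairInf hl hl')
  obtain ⟨i2, e2⟩ := integral_rotation_average (hF.sub hTi)
  have hpt : ∀ x, d * ∫ θ in (0 : ℝ)..2 * Real.pi,
      sqExpSq l (pairInf q (ContinuousLinearMap.rotation θ x)) ≤
      ∫ θ in (0 : ℝ)..2 * Real.pi, (forwardTerm q l d - T) (ContinuousLinearMap.rotation θ x) := by
    intro x
    refine (hq.mul_integral_circle_le hl.le hd hd1 x).trans_eq ?_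
    congr 1
    funext θ
    simp only [Pi.sub_apply, T, forwardTerm, circle_rotation, add_zero, ← sub_eq_add_neg, mul_sub]
  have hmono := integral_mono (i1.const_mul d) i2 hpt
  rw [integral_const_mul, e1, e2, Pi.sub_def, integral_sub hF hTi, hTint,
    ← integral_sub hF hB] at hmono
  have hpi := Real.two_pi_pos
  refine le_of_mul_le_mul_left ?_ hpi
  linarith

lemma ae_differentiableAt_fst (hq : IsConeDist q) :
    ∀ᵐ x ∂((stdGaussian E).prod (stdGaussian E)), DifferentiableAt ℝ q x.1 := by
  have h := stdGaussian_absolutelyContinuous.ae_le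
    (hq.lipschitzWith.ae_differentiableAt (μ := (volume : Measure E)))
  exact Measure.quasiMeasurePreserving_fst.ae h

lemma integrable_limitTerm (hq : IsConeDist q) (hl : 0 < l) (hl' : l ≤ 1 / 100) :
    Integrable (limitTerm q l) ((stdGaussian E).prod (stdGaussian E)) ∧
    Tendsto (fun d : ℝ => ∫ x, (forwardTerm q l d x - backwardTerm q l d x) / d
        ∂((stdGaussian E).prod (stdGaussian E))) (𝓝[>] 0)
      (𝓝 (∫ x, limitTerm q l x ∂((stdGaussian E).prod (stdGaussian E)))) := by
  set P := (stdGaussian E).prod (stdGaussian E)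
  have hlim : ∀ᵐ x ∂P, Tendsto (fun d : ℝ => (forwardTerm q l d x - backwardTerm q l d x) / d)
      (𝓝[>] 0) (𝓝 (limitTerm q l x)) :=
    hq.ae_differentiableAt_fst.mono fun x hx => tendsto_term_div x hx
  have hmeas : ∀ d : ℝ, AEStronglyMeasurable
      (fun x => (forwardTerm q l d x - backwardTerm q l d x) / d) P := fun d =>
    (((hq.continuous_forwardTerm l d).sub (hq.continuous_backwardTerm l d)).div_const d
      ).aestronglyMeasurable
  have hbound : ∀ᶠ d : ℝ in 𝓝[>] 0, ∀ x, ‖(forwardTerm q l d x - backwardTerm q l d x) / d‖ ≤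
      4 * (1 + ‖x.1‖ + ‖x.2‖) ^ 2 * Real.exp (7 * l * (1 + ‖x.1‖ + ‖x.2‖) ^ 2) := by
    filter_upwards [Ioo_mem_nhdsGT (zero_lt_one' ℝ)] with d hd x
    rw [norm_div, Real.norm_of_nonneg hd.1.le, div_le_iff₀ hd.1, Real.norm_eq_abs]
    linarith [(hq.abs_terms_le hl.le hd.1 hd.2.le x).2.2]
  refine ⟨(integrable_sq_mul_exp_radius (E := E) hl hl').mono'
    (aestronglyMeasurable_of_tendsto_ae (𝓝[>] 0) hmeas hlim) ?_,
    tendsto_integral_filter_of_dominated_convergence _ (Eventually.of_forall hmeas)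
    (hbound.mono fun d h => ae_of_all _ h) (integrable_sq_mul_exp_radius (E := E) hl hl') hlim⟩
  filter_upwards [hlim] with x hx
  exact le_of_tendsto hx.norm (hbound.mono fun d h => h x)

lemma integral_limitTerm_le (hq : IsConeDist q) (hl : 0 < l) (hl' : l ≤ 1 / 100) {h : E}
    (hd : DifferentiableAt ℝ q h) :
    ∫ g, limitTerm q l (h, g) ∂stdGaussian E ≤ √(1 - 2 * l) * sqExpSq l (q h) := by
  have hhalf : l < 1 / 2 := by linarith
  have hw : 0 < 1 - 2 * l := by linarith
  rcases (hq.nonneg h).eq_or_lt with h0 | h0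
  · have : ∀ g, limitTerm q l (h, g) = 0 := fun g => by
      simp [limitTerm, ← h0, hq.fderiv_eq_zero h0.symm]
    simp only [this, integral_zero]
    exact mul_nonneg (Real.sqrt_nonneg _) (sqExpSq_nonneg _ _)
  · set L := fderiv ℝ q h
    have hL := map_dual_stdGaussian L (hq.norm_fderiv h0 hd)
    have hLm : AEMeasurable L (stdGaussian E) := L.continuous.measurable.aemeasurable
    let Ψ : ℝ → ℝ := fun y => mulExpSq l (q h) * q h * Real.exp (l * y ^ 2) -
      (1 + 2 * l * q h ^ 2) * Real.exp (l * q h ^ 2) * (y * expSqPrimitive l y)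
    have hΨ : Continuous Ψ := by
      have := continuous_expSqPrimitive l
      fun_prop
    have e1 : ∫ g, limitTerm q l (h, g) ∂stdGaussian E = ∫ y, Ψ y ∂gaussianReal 0 1 := by
      rw [← hL, integral_map hLm hΨ.aestronglyMeasurable]
      rfl
    rw [e1, integral_sub ((integrable_exp_mul_sq_gaussianReal hhalf).const_mul _)
      ((integrable_mul_expSqPrimitive hl.le hhalf).const_mul _), integral_const_mul,
      integral_const_mul, integral_mul_expSqPrimitive hl.le hhalf,
      integral_exp_mul_sq_gaussianReal hhalf]
    have hs : 0 < √(1 - 2 * l) := Real.sqrt_pos.2 hw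
    have e2 : mulExpSq l (q h) * q h * (√(1 - 2 * l))⁻¹ -
        (1 + 2 * l * q h ^ 2) * Real.exp (l * q h ^ 2) * (√(1 - 2 * l))⁻¹ =
        (√(1 - 2 * l))⁻¹ * (Real.exp (l * q h ^ 2) * ((1 - 2 * l) * q h ^ 2 - 1)) := by
      rw [mulExpSq]; ring
    rw [e2, inv_mul_le_iff₀ hs, ← mul_assoc, Real.mul_self_sqrt hw.le, sqExpSq]
    nlinarith [Real.exp_pos (l * q h ^ 2)]

lemma integrable_sqExpSq (hq : IsConeDist q) (hl : 0 < l) (hl' : l ≤ 1 / 100) :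
    Integrable (fun h => sqExpSq l (q h)) (stdGaussian E) := by
  refine ((integrable_exp_mul_norm_sq_stdGaussian (E := E) (c := 2 * l) (by linarith)).const_mul
    (2 * l - l)⁻¹).mono' ((continuous_sqExpSq l).comp hq.continuous).aestronglyMeasurable
    (ae_of_all _ fun h => ?_)
  rw [Real.norm_of_nonneg (sqExpSq_nonneg _ _)]
  exact (sqExpSq_le_sqExpSq hl.le (hq.nonneg h) (hq.le_norm h)).trans (sq_mul_exp_le (by linarith))

lemma integral_sqExpSq_pairInf_le (hq : IsConeDist q) (hl : 0 < l) (hl' : l ≤ 1 / 100) :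
    ∫ x, sqExpSq l (pairInf q x) ∂((stdGaussian E).prod (stdGaussian E)) ≤
      √(1 - 2 * l) * ∫ h, sqExpSq l (q h) ∂stdGaussian E := by
  obtain ⟨hi, ht⟩ := hq.integrable_limitTerm (E := E) hl hl'
  have h1 : ∫ x, sqExpSq l (pairInf q x) ∂((stdGaussian E).prod (stdGaussian E)) ≤
      ∫ x, limitTerm q l x ∂((stdGaussian E).prod (stdGaussian E)) := by
    refine ge_of_tendsto ht ?_
    filter_upwards [Ioo_mem_nhdsGT (zero_lt_one' ℝ)] with d hd
    rw [integral_div, le_div_iff₀ hd.1, mul_comm]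
    exact hq.mul_integral_pairInf_le hl hl' hd.1 hd.2.le
  refine h1.trans ?_
  rw [integral_prod _ hi, ← integral_const_mul]
  refine integral_mono_ae hi.integral_prod_left ((hq.integrable_sqExpSq hl hl').const_mul _) ?_
  have hae : ∀ᵐ h ∂stdGaussian E, DifferentiableAt ℝ q h :=
    stdGaussian_absolutelyContinuous.ae_le
      (hq.lipschitzWith.ae_differentiableAt (μ := (volume : Measure E)))
  exact hae.mono fun h hd => hq.integral_limitTerm_le hl hl' hd

/-- Taking the infimum along one more Gaussian direction contracts the exponential moment. -/
lemma lintegral_sqExpSq_infRange_le (hq : IsConeDist q) (hl : 0 < l) (hl' : l ≤ 1 / 100) :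
    ∫⁻ g, ∫⁻ h, ENNReal.ofReal (sqExpSq l (_root_.infRange q (LinearMap.toSpanSingleton ℝ E g) h))
        ∂stdGaussian E ∂stdGaussian E ≤
      ENNReal.ofReal √(1 - 2 * l) * ∫⁻ h, ENNReal.ofReal (sqExpSq l (q h)) ∂stdGaussian E := by
  have hm : Measurable fun x : E × E => ENNReal.ofReal (sqExpSq l (pairInf q x)) :=
    ((continuous_sqExpSq l).measurable.comp hq.measurable_pairInf).ennreal_ofReal
  have e := lintegral_prod_symm (μ := stdGaussian E) (ν := stdGaussian E) _ hm.aemeasurable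
  rw [← ofReal_integral_eq_lintegral_ofReal (hq.integrable_sqExpSq_pairInf hl hl')
    (ae_of_all _ fun x => sqExpSq_nonneg _ _)] at e
  refine (e.symm.trans_le (ENNReal.ofReal_le_ofReal (hq.integral_sqExpSq_pairInf_le hl hl'))).trans_eq ?_
  rw [ENNReal.ofReal_mul (Real.sqrt_nonneg _),
    ofReal_integral_eq_lintegral_ofReal (hq.integrable_sqExpSq hl hl')
    (ae_of_all _ fun x => sqExpSq_nonneg _ _)]

end IsConeDist

namespace IsConeDist

lemma infRange_cons_le {E : Type*} [NormedAddCommGroup E] [NormedSpace ℝ E] {q : E → ℝ} {m : ℕ}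
    (hq : IsConeDist q) (g : E) (G : Fin m → E) (h : E) :
    _root_.infRange q (Fintype.linearCombination ℝ (Fin.cons g G : Fin (m + 1) → E)) h ≤
      _root_.infRange (_root_.infRange q (Fintype.linearCombination ℝ G))
        (LinearMap.toSpanSingleton ℝ E g) h := by
  refine le_ciInf fun c => le_ciInf fun a => ?_
  refine (hq.infRange_le _ h (Fin.cons c a : Fin (m + 1) → ℝ)).trans_eq ?_
  congr 1
  simp [Fintype.linearCombination_apply, Fin.sum_univ_succ, sub_sub]

section Iteration

variable {E : Type*} [NormedAddCommGroup E] [InnerProductSpace ℝ E] [FiniteDimensional ℝ E]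
  [MeasurableSpace E] [BorelSpace E] {q : E → ℝ} {l : ℝ} {m : ℕ}

lemma measurable_infRange_linearCombination (hq : IsConeDist q) :
    Measurable fun x : (Fin m → E) × E =>
      _root_.infRange q (Fintype.linearCombination ℝ x.1) x.2 := by
  refine UpperSemicontinuous.measurable ?_
  refine upperSemicontinuous_ciInf (fun x => hq.bddBelow _ _) fun t => ?_
  simp only [Fintype.linearCombination_apply]
  exact (hq.continuous.comp (by fun_prop)).upperSemicontinuous

lemma measurable_lintegral_infRange (hq : IsConeDist q) :
    Measurable fun G : Fin m → E => ∫⁻ h, ENNReal.ofReal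
      (sqExpSq l (_root_.infRange q (Fintype.linearCombination ℝ G) h)) ∂stdGaussian E :=
  ((continuous_sqExpSq l).measurable.comp
    hq.measurable_infRange_linearCombination).ennreal_ofReal.lintegral_prod_right'

/-- Taking the infimum along `m` independent Gaussian directions contracts the exponential moment
geometrically in `m`. -/
lemma lintegral_linearCombination_le (hq : IsConeDist q) (hl : 0 < l) (hl' : l ≤ 1 / 100) (m : ℕ) :
    ∫⁻ G : Fin m → E, ∫⁻ h, ENNReal.ofReal
        (sqExpSq l (_root_.infRange q (Fintype.linearCombination ℝ G) h)) ∂stdGaussian E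
        ∂(Measure.pi fun _ => stdGaussian E) ≤
      ENNReal.ofReal √(1 - 2 * l) ^ m *
        ∫⁻ h, ENNReal.ofReal (sqExpSq l (q h)) ∂stdGaussian E := by
  induction m with
  | zero =>
    rw [pow_zero, one_mul]
    calc _ ≤ ∫⁻ _ : Fin 0 → E, ∫⁻ h, ENNReal.ofReal (sqExpSq l (q h)) ∂stdGaussian E
          ∂(Measure.pi fun _ => stdGaussian E) := by
          refine lintegral_mono fun G => lintegral_mono fun h => ENNReal.ofReal_le_ofReal
            (sqExpSq_le_sqExpSq hl.le ((hq.infRange _).nonneg h) ?_)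
          refine (hq.infRange_le (Fintype.linearCombination ℝ G) h 0).trans_eq ?_
          rw [map_zero, sub_zero]
      _ = _ := by rw [lintegral_const, measure_univ, mul_one]
  | succ m ih =>
    have e := (measurePreserving_piFinSuccAbove (fun _ : Fin (m + 1) => stdGaussian E) 0).symm
    rw [← e.lintegral_comp hq.measurable_lintegral_infRange]
    refine (lintegral_prod_symm' _
      (hq.measurable_lintegral_infRange.comp e.measurable)).trans_le ?_
    rw [pow_succ, mul_comm (_ ^ m), mul_assoc]
    refine le_trans ?_ (mul_le_mul_right ih _)
    rw [← lintegral_const_mul' _ _ ENNReal.ofReal_ne_top]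
    refine lintegral_mono fun G => le_trans (lintegral_mono fun g => lintegral_mono fun h => ?_)
      ((hq.infRange (Fintype.linearCombination ℝ G)).lintegral_sqExpSq_infRange_le hl hl')
    refine ENNReal.ofReal_le_ofReal
      (sqExpSq_le_sqExpSq hl.le ((hq.infRange _).nonneg h) ?_)
    have hG : (MeasurableEquiv.piFinSuccAbove (fun _ : Fin (m + 1) => E) 0).symm (g, G) =
        Fin.cons g G := Fin.insertNth_zero' g G
    rw [hG]
    exact hq.infRange_cons_le g G h

end Iteration

end IsConeDist

lemma lintegral_pi_prod {α : Type*} [MeasurableSpace α] (ν : Measure α) [SigmaFinite ν] :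
    ∀ {n : ℕ} (f : Fin n → α → ℝ≥0∞), (∀ i, Measurable (f i)) →
      ∫⁻ x : Fin n → α, ∏ i, f i (x i) ∂(Measure.pi fun _ => ν) = ∏ i, ∫⁻ a, f i a ∂ν := by
  intro n
  induction n with
  | zero => intro f _; simp
  | succ n ih =>
    intro f hf
    have e := (measurePreserving_piFinSuccAbove (fun _ : Fin (n + 1) => ν) 0).symm
    rw [← e.lintegral_comp (by fun_prop), Fin.prod_univ_succ, ← ih _ fun i => hf i.succ,
      ← lintegral_prod_mul (hf 0).aemeasurable
      (Finset.measurable_prod _ fun i _ => (hf i.succ).comp (measurable_pi_apply i)).aemeasurable]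
    refine lintegral_congr fun x => ?_
    rw [Fin.prod_univ_succ]
    rfl

section Orthant

variable {n : ℕ}

/-- The norm of the componentwise positive part. -/
def posPartNorm (h : EuclideanSpace ℝ (Fin n)) : ℝ := √(∑ i, (max (h i) 0) ^ 2)

lemma posPartNorm_sq (h : EuclideanSpace ℝ (Fin n)) :
    posPartNorm h ^ 2 = ∑ i, (max (h i) 0) ^ 2 := Real.sq_sqrt (by positivity)

lemma posPartNorm_eq_norm (h : EuclideanSpace ℝ (Fin n)) :
    posPartNorm h = ‖(WithLp.toLp 2 fun i => max (h i) 0 : EuclideanSpace ℝ (Fin n))‖ := by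
  simp [posPartNorm, EuclideanSpace.norm_eq]

lemma isConeDist_posPartNorm : IsConeDist (posPartNorm (n := n)) where
  nonneg h := Real.sqrt_nonneg _
  smul c hc h := by
    have : ∑ i, (max ((c • h) i) 0) ^ 2 = c ^ 2 * ∑ i, (max (h i) 0) ^ 2 := by
      rw [Finset.mul_sum]
      refine Finset.sum_congr rfl fun i _ => ?_
      rw [PiLp.smul_apply, smul_eq_mul, ← mul_zero c, ← mul_max_of_nonneg _ _ hc, mul_zero, mul_pow]
    rw [posPartNorm, this, Real.sqrt_mul (sq_nonneg c), Real.sqrt_sq hc, posPartNorm]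
  add_le h k := by
    calc posPartNorm (h + k) ≤ ‖(WithLp.toLp 2 fun i => max (h i) 0 : EuclideanSpace ℝ (Fin n)) +
          (WithLp.toLp 2 fun i => max (k i) 0 : EuclideanSpace ℝ (Fin n))‖ := by
          rw [posPartNorm, EuclideanSpace.norm_eq]
          refine Real.sqrt_le_sqrt (Finset.sum_le_sum fun i _ => ?_)
          rw [Real.norm_eq_abs, sq_abs]
          refine pow_le_pow_left₀ (le_max_right _ _) ?_ 2
          exact max_le (add_le_add (le_max_left _ _) (le_max_left _ _))
            (add_nonneg (le_max_right _ _) (le_max_right _ _))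
      _ ≤ _ := (norm_add_le _ _).trans_eq (by rw [posPartNorm_eq_norm, posPartNorm_eq_norm])
  le_norm h := by
    rw [posPartNorm, EuclideanSpace.norm_eq]
    refine Real.sqrt_le_sqrt (Finset.sum_le_sum fun i _ => ?_)
    exact pow_le_pow_left₀ (le_max_right _ _) (max_le (le_abs_self _) (abs_nonneg _)) 2
  exists_zero h η hη := by
    refine ⟨WithLp.toLp 2 fun i => max (h i) 0, by rw [posPartNorm_eq_norm]; linarith, ?_⟩
    rw [posPartNorm, Real.sqrt_eq_zero (by positivity)]
    refine Finset.sum_eq_zero fun i _ => ?_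
    rw [PiLp.sub_apply, max_eq_right (by simp), zero_pow two_ne_zero]

lemma inner_le_posPartNorm {u : EuclideanSpace ℝ (Fin n)} (hu : ‖u‖ = 1) (hu0 : ∀ i, 0 ≤ u i)
    (h : EuclideanSpace ℝ (Fin n)) : inner ℝ u h ≤ posPartNorm h := by
  rw [posPartNorm_eq_norm]
  have key := real_inner_le_norm u (WithLp.toLp 2 fun i => max (h i) 0)
  rw [hu, one_mul] at key
  refine le_trans ?_ key
  rw [PiLp.inner_apply, PiLp.inner_apply]
  refine Finset.sum_le_sum fun i _ => ?_
  simp only [RCLike.inner_apply, conj_trivial]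
  exact mul_le_mul_of_nonneg_right (le_max_left _ _) (hu0 i)

/-- A subspace that misses the open positive orthant has a unit normal vector with nonnegative
coordinates. -/
lemma exists_unit_nonneg_orthogonal (S : Submodule ℝ (EuclideanSpace ℝ (Fin n)))
    (hS : ∀ s ∈ S, ¬ ∀ i, 0 < s i) :
    ∃ u : EuclideanSpace ℝ (Fin n), ‖u‖ = 1 ∧ (∀ i, 0 ≤ u i) ∧ ∀ s ∈ S, inner ℝ u s = 0 := by
  let O : Set (EuclideanSpace ℝ (Fin n)) := {x | ∀ i, 0 < x i}
  have hO : IsOpen O := by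
    have : O = ⋂ i, {x | 0 < x i} := by ext; simp [O]
    rw [this]
    exact isOpen_iInter_of_finite fun i => isOpen_lt continuous_const (by fun_prop)
  have hOc : Convex ℝ O := by
    intro x hx y hy a b ha hb hab i
    have h1 := hx i
    have h2 := hy i
    simp only [PiLp.add_apply, PiLp.smul_apply, smul_eq_mul]
    rcases ha.eq_or_lt with rfl | ha
    · have : b = 1 := by linarith
      subst this; linarith
    · have := mul_pos ha h1
      have := mul_nonneg hb h2.le
      linarith
  obtain ⟨f, r, hf, hr⟩ := geometric_hahn_banach_open hOc hO S.convex
    (Set.disjoint_left.2 fun x hx hxS => hS x hxS hx)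
  have hr0 : r ≤ 0 := by simpa using hr 0 S.zero_mem
  have hS0 : ∀ s ∈ S, f s = 0 := by
    intro s hs
    by_contra hne
    have := hr (((r - 1) / f s) • s) (S.smul_mem _ hs)
    rw [map_smul, smul_eq_mul, div_mul_cancel₀ _ hne] at this
    linarith
  have hO0 : ∀ x ∈ O, f x < 0 := fun x hx => (hf x hx).trans_le hr0
  let v := (InnerProductSpace.toDual ℝ (EuclideanSpace ℝ (Fin n))).symm (-f)
  have hv : ∀ x, inner ℝ v x = -f x := fun x => by
    simp [v, InnerProductSpace.toDual_symm_apply]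
  have hone : (WithLp.toLp 2 fun _ => 1 : EuclideanSpace ℝ (Fin n)) ∈ O := fun i => zero_lt_one
  have hv0 : v ≠ 0 := by
    intro h0
    have := hv (WithLp.toLp 2 fun _ => 1)
    rw [h0, inner_zero_left] at this
    have := hO0 _ hone
    linarith
  have hvn : ∀ i, 0 ≤ v i := by
    intro i
    have hlim : Tendsto (fun d : ℝ => f (EuclideanSpace.single i (1 : ℝ) +
        d • (WithLp.toLp 2 fun _ => 1 : EuclideanSpace ℝ (Fin n)))) (𝓝[>] 0)
        (𝓝 (f (EuclideanSpace.single i (1 : ℝ) +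
        (0 : ℝ) • (WithLp.toLp 2 fun _ => 1 : EuclideanSpace ℝ (Fin n))))) :=
      (Continuous.tendsto (by fun_prop) 0).mono_left nhdsWithin_le_nhds
    have hle := le_of_tendsto hlim (b := 0) (eventually_mem_nhdsWithin.mono fun d hd =>
      (hO0 _ fun j => by
        have : (0 : ℝ) ≤ (EuclideanSpace.single i (1 : ℝ) : EuclideanSpace ℝ (Fin n)) j := by
          rw [PiLp.single_apply]; split_ifs <;> norm_num
        have hd : (0 : ℝ) < d := hd
        simp only [PiLp.add_apply, PiLp.smul_apply, smul_eq_mul, mul_one]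
        linarith).le)
    rw [zero_smul, add_zero] at hle
    have := hv (EuclideanSpace.single i 1)
    rw [EuclideanSpace.inner_single_right] at this
    simp only [one_mul, conj_trivial] at this
    linarith
  refine ⟨‖v‖⁻¹ • v, norm_smul_inv_norm hv0, fun i => ?_, fun s hs => ?_⟩
  · rw [PiLp.smul_apply, smul_eq_mul]
    exact mul_nonneg (by positivity) (hvn i)
  · rw [real_inner_smul_left, hv, hS0 s hs, neg_zero, mul_zero]

end Orthant

section Orthant

variable {n : ℕ} {l k : ℝ}

lemma lintegral_sqExpSq_posPartNorm_le (V : EuclideanSpace ℝ (Fin n)) (t : ℝ) (hl : 0 < l)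
    (hlk : l < k) :
    ∫⁻ h, ENNReal.ofReal (sqExpSq l
        (infRange posPartNorm (LinearMap.toSpanSingleton ℝ _ V) h)) ∂stdGaussian _ ≤
      ENNReal.ofReal (k - l)⁻¹ * ∏ i, ∫⁻ z, ENNReal.ofReal
        (Real.exp (k * (max (z - t * V i) 0) ^ 2)) ∂gaussianReal 0 1 := by
  have hm : ∀ i, Measurable fun z : ℝ =>
      ENNReal.ofReal (Real.exp (k * (max (z - t * V i) 0) ^ 2)) := fun i => by fun_prop
  calc _ ≤ ∫⁻ h : EuclideanSpace ℝ (Fin n), ENNReal.ofReal (k - l)⁻¹ *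
        ∏ i, ENNReal.ofReal (Real.exp (k * (max (h i - t * V i) 0) ^ 2)) ∂stdGaussian _ := by
        refine lintegral_mono fun h => ?_
        rw [← ENNReal.ofReal_prod_of_nonneg fun i _ => (Real.exp_pos _).le, ← Real.exp_sum,
          ← Finset.mul_sum, ← ENNReal.ofReal_mul (inv_nonneg.2 (sub_nonneg.2 hlk.le))]
        refine ENNReal.ofReal_le_ofReal ?_
        refine (sqExpSq_le_sqExpSq hl.le ((isConeDist_posPartNorm.infRange _).nonneg h)
          (isConeDist_posPartNorm.infRange_le _ h t)).trans ((sq_mul_exp_le hlk).trans_eq ?_)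
        rw [posPartNorm_sq]
        simp
    _ = _ := by
        rw [lintegral_const_mul' _ _ ENNReal.ofReal_ne_top, ← map_pi_eq_stdGaussian,
          lintegral_map (by fun_prop) (by fun_prop), ← lintegral_pi_prod _ _ hm]

/-- The moment of the positive part of a standard Gaussian that bounds the left side of Markov's
inequality. -/
def posPartMoment (l : ℝ) : ℝ≥0∞ := ∫⁻ z, ENNReal.ofReal (sqExpSq l (max z 0)) ∂gaussianReal 0 1

lemma posPartMoment_ne_zero (l : ℝ) : posPartMoment l ≠ 0 := by
  intro h0
  have hm : Measurable fun z : ℝ => ENNReal.ofReal (sqExpSq l (max z 0)) :=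
    ((continuous_sqExpSq l).comp (by fun_prop)).measurable.ennreal_ofReal
  rw [posPartMoment, lintegral_eq_zero_iff hm] at h0
  have h1 := (gaussianReal_absolutelyContinuous' 0 one_ne_zero).ae_le h0
  have h2 : ∀ᵐ z : ℝ, z ∉ Set.Ioi (0 : ℝ) := by
    filter_upwards [h1] with z hz hz0
    have hz0 : 0 < z := hz0
    rw [Pi.zero_apply, ENNReal.ofReal_eq_zero, max_eq_left hz0.le, sqExpSq] at hz
    have : 0 < z ^ 2 * Real.exp (l * z ^ 2) := by positivity
    linarith
  have h3 := measure_eq_zero_iff_ae_notMem.2 h2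
  simp at h3

lemma posPartMoment_ne_top (hl : 0 < l) (hl' : l ≤ 1 / 100) : posPartMoment l ≠ ∞ := by
  refine ne_top_of_le_ne_top
    (integrable_sq_mul_exp_gaussianReal (l := l) (by linarith)).lintegral_lt_top.ne
    (lintegral_mono fun z => ENNReal.ofReal_le_ofReal ?_)
  refine (sqExpSq_le_sqExpSq hl.le (le_max_right _ _)
    (max_le (le_abs_self z) (abs_nonneg z))).trans_eq ?_
  rw [sqExpSq, sq_abs]

lemma posPartMoment_le (hl : 0 < l) (V : EuclideanSpace ℝ (Fin n)) {m : ℕ}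
    (G : Fin m → EuclideanSpace ℝ (Fin n))
    (hG : ¬ ∃ (t : ℝ) (c : Fin m → ℝ), ∀ i, 0 < t * V i + ∑ j, c j * G j i) :
    posPartMoment l ≤ ∫⁻ h, ENNReal.ofReal (sqExpSq l
      (infRange (infRange posPartNorm (LinearMap.toSpanSingleton ℝ _ V))
        (Fintype.linearCombination ℝ G) h)) ∂stdGaussian _ := by
  obtain ⟨u, hu, hu0, huS⟩ := exists_unit_nonneg_orthogonal
    (LinearMap.range ((LinearMap.toSpanSingleton ℝ _ V).coprod (Fintype.linearCombination ℝ G)))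
    (by
      rintro _ ⟨⟨t, c⟩, rfl⟩ hs
      refine hG ⟨t, c, fun i => ?_⟩
      simpa [Fintype.linearCombination_apply] using hs i)
  have hL : (stdGaussian (EuclideanSpace ℝ (Fin n))).map (innerSL ℝ u) = gaussianReal 0 1 :=
    map_dual_stdGaussian _ (by rw [innerSL_apply_norm, hu])
  have hm : Measurable fun z : ℝ => ENNReal.ofReal (sqExpSq l (max z 0)) :=
    ((continuous_sqExpSq l).comp (by fun_prop)).measurable.ennreal_ofReal
  rw [posPartMoment, ← hL, lintegral_map hm (by fun_prop)]
  refine lintegral_mono fun h => ENNReal.ofReal_le_ofReal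
    (sqExpSq_le_sqExpSq hl.le (le_max_right _ _) ?_)
  refine le_ciInf fun c => le_ciInf fun t => max_le ?_ (isConeDist_posPartNorm.nonneg _)
  refine le_trans (le_of_eq ?_) (inner_le_posPartNorm hu hu0 _)
  have := huS _ ⟨(t, c), rfl⟩
  rw [LinearMap.coprod_apply, inner_add_right] at this
  rw [innerSL_apply_apply, inner_sub_right, inner_sub_right]
  linarith

/-- Probability that a fixed vector and `m` Gaussian vectors span no strictly positive vector. -/
lemma measure_not_exists_pos_le (hl : 0 < l) (hl' : l ≤ 1 / 100) (hlk : l < k) (t : ℝ)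
    (V : EuclideanSpace ℝ (Fin n)) (m : ℕ) :
    (Measure.pi fun _ : Fin m => stdGaussian (EuclideanSpace ℝ (Fin n)))
        {G | ¬ ∃ (t : ℝ) (c : Fin m → ℝ), ∀ i, 0 < t * V i + ∑ j, c j * G j i} ≤
      (posPartMoment l)⁻¹ * (ENNReal.ofReal √(1 - 2 * l) ^ m * (ENNReal.ofReal (k - l)⁻¹ *
        ∏ i, ∫⁻ z, ENNReal.ofReal
          (Real.exp (k * (max (z - t * V i) 0) ^ 2)) ∂gaussianReal 0 1)) := by
  have hq := isConeDist_posPartNorm.infRange (LinearMap.toSpanSingleton ℝ _ V)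
  have h1 := mul_meas_ge_le_lintegral (μ := Measure.pi fun _ : Fin m => stdGaussian _)
    (hq.measurable_lintegral_infRange (l := l)) (posPartMoment l)
  have h2 := h1.trans (hq.lintegral_linearCombination_le hl hl' m)
  rw [← ENNReal.div_eq_inv_mul, ENNReal.le_div_iff_mul_le (Or.inl (posPartMoment_ne_zero l))
    (Or.inl (posPartMoment_ne_top hl hl')), mul_comm]
  refine le_trans ?_ (h2.trans
    (mul_le_mul_right (lintegral_sqExpSq_posPartNorm_le V t hl hlk) _))
  exact mul_le_mul_right (measure_mono fun G hG => posPartMoment_le hl V G hG) _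

end Orthant

lemma measurePreserving_pi_swap {ι κ α : Type*} [Fintype ι] [Fintype κ] [MeasurableSpace α]
    (ν : Measure α) [IsProbabilityMeasure ν] :
    MeasurePreserving (fun (x : ι → κ → α) k i => x i k)
      (Measure.pi fun _ : ι => Measure.pi fun _ : κ => ν)
      (Measure.pi fun _ : κ => Measure.pi fun _ : ι => ν) := by
  have h1 : MeasurePreserving (MeasurableEquiv.curry ι κ α).symm
      (Measure.pi fun _ : ι => Measure.pi fun _ : κ => ν) (Measure.pi fun _ : ι × κ => ν) := by
    refine ⟨MeasurableEquiv.measurable _, ?_⟩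
    have := Measure.infinitePi_map_curry_symm (fun (_ : ι) (_ : κ) => ν)
    simp only [Measure.infinitePi_eq_pi] at this
    exact this
  have h2 := measurePreserving_piCongrLeft (fun _ : κ × ι => ν) (Equiv.prodComm ι κ)
  have h3 : MeasurePreserving (MeasurableEquiv.curry κ ι α)
      (Measure.pi fun _ : κ × ι => ν) (Measure.pi fun _ : κ => Measure.pi fun _ : ι => ν) := by
    refine ⟨MeasurableEquiv.measurable _, ?_⟩
    have := Measure.infinitePi_map_curry (fun (_ : κ) (_ : ι) => ν)
    simp only [Measure.infinitePi_eq_pi] at this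
    exact this
  exact (h3.comp h2).comp h1

lemma measurePreserving_toLp (ι : Type*) [Fintype ι] :
    MeasurePreserving (WithLp.toLp 2 : (ι → ℝ) → EuclideanSpace ℝ ι)
      (Measure.pi fun _ : ι => gaussianReal 0 1) (stdGaussian (EuclideanSpace ℝ ι)) :=
  ⟨by fun_prop, map_pi_eq_stdGaussian⟩

lemma measurePreserving_ofLp (ι : Type*) [Fintype ι] :
    MeasurePreserving (WithLp.ofLp : EuclideanSpace ℝ ι → ι → ℝ)
      (stdGaussian (EuclideanSpace ℝ ι)) (Measure.pi fun _ : ι => gaussianReal 0 1) := by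
  refine ⟨by fun_prop, ?_⟩
  rw [← map_pi_eq_stdGaussian, Measure.map_map (by fun_prop) (by fun_prop)]
  exact Measure.map_id

section Rows

variable {n p : ℕ}

/-- Coordinates of the rescaled row `√n • x` after the isometry `f`. -/
def rotateRow (n : ℕ) (f : EuclideanSpace ℝ (Fin p) ≃ₗᵢ[ℝ] EuclideanSpace ℝ (Fin p))
    (x : Fin p → ℝ) : Fin p → ℝ :=
  (f (WithLp.toLp 2 fun j => √n * x j)).ofLp

lemma measurePreserving_rotateRow (hn : n ≠ 0)
    (f : EuclideanSpace ℝ (Fin p) ≃ₗᵢ[ℝ] EuclideanSpace ℝ (Fin p)) :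
    MeasurePreserving (rotateRow n f) (Measure.pi fun _ => gaussianReal 0 ((n : ℝ≥0))⁻¹)
      (Measure.pi fun _ => gaussianReal 0 1) := by
  have h1 : MeasurePreserving (fun x : ℝ => √n * x) (gaussianReal 0 ((n : ℝ≥0))⁻¹)
      (gaussianReal 0 1) := by
    refine ⟨by fun_prop, ?_⟩
    rw [gaussianReal_map_const_mul, mul_zero]
    congr 1
    ext
    simp [Real.sq_sqrt, hn]
  have h2 := measurePreserving_pi (fun _ : Fin p => gaussianReal 0 ((n : ℝ≥0))⁻¹)
    (fun _ => gaussianReal 0 1) fun _ => h1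
  have h3 : MeasurePreserving f (stdGaussian _) (stdGaussian _) :=
    ⟨f.continuous.measurable, stdGaussian_map f⟩
  exact ((measurePreserving_ofLp _).comp h3).comp ((measurePreserving_toLp _).comp h2)

/-- Columns of the rotated design matrix. -/
def rotateDesign (f : EuclideanSpace ℝ (Fin p) ≃ₗᵢ[ℝ] EuclideanSpace ℝ (Fin p))
    (X : Fin n → Fin p → ℝ) : Fin p → EuclideanSpace ℝ (Fin n) :=
  fun k => WithLp.toLp 2 fun i => rotateRow n f (X i) k

lemma measurePreserving_rotateDesign (hn : n ≠ 0)
    (f : EuclideanSpace ℝ (Fin p) ≃ₗᵢ[ℝ] EuclideanSpace ℝ (Fin p)) :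
    MeasurePreserving (rotateDesign (n := n) f)
      (Measure.pi fun _ => Measure.pi fun _ => gaussianReal 0 ((n : ℝ≥0))⁻¹)
      (Measure.pi fun _ => stdGaussian (EuclideanSpace ℝ (Fin n))) := by
  have h1 := measurePreserving_pi
    (fun _ : Fin n => Measure.pi fun _ : Fin p => gaussianReal 0 ((n : ℝ≥0))⁻¹)
    (fun _ => Measure.pi fun _ => gaussianReal 0 1) fun _ => measurePreserving_rotateRow hn f
  have h2 := measurePreserving_pi_swap (ι := Fin n) (κ := Fin p) (gaussianReal 0 1)
  have h3 := measurePreserving_pi (fun _ : Fin p => Measure.pi fun _ : Fin n => gaussianReal 0 1)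
    (fun _ => stdGaussian (EuclideanSpace ℝ (Fin n))) fun _ => measurePreserving_toLp _
  exact (h3.comp h2).comp h1

lemma sum_mul_eq_sum_rotateRow (f : EuclideanSpace ℝ (Fin p) ≃ₗᵢ[ℝ] EuclideanSpace ℝ (Fin p))
    (x b : Fin p → ℝ) :
    √n * ∑ j, x j * b j = ∑ k, rotateRow n f x k * f (WithLp.toLp 2 b) k := by
  have h := f.inner_map_map (WithLp.toLp 2 b) (WithLp.toLp 2 fun j => √n * x j)
  simp only [PiLp.inner_apply, RCLike.inner_apply, conj_trivial] at h
  rw [rotateRow, h, Finset.mul_sum]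
  simp only [mul_assoc]

lemma exists_isometry_map_eq_single {m : ℕ} (β : EuclideanSpace ℝ (Fin (m + 1))) (hβ : β ≠ 0) :
    ∃ f : EuclideanSpace ℝ (Fin (m + 1)) ≃ₗᵢ[ℝ] EuclideanSpace ℝ (Fin (m + 1)),
      f β = EuclideanSpace.single 0 ‖β‖ := by
  have ho : Orthonormal ℝ (({0} : Set (Fin (m + 1))).domRestrict fun _ => ‖β‖⁻¹ • β) := by
    refine ⟨fun _ => norm_smul_inv_norm hβ, fun i j hij => ?_⟩
    exact absurd (Subsingleton.elim i j) hij
  obtain ⟨e, he⟩ := ho.exists_orthonormalBasis_extension_of_card_eq (by simp)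
  refine ⟨e.repr, ?_⟩
  have h0 : β = ‖β‖ • e 0 := by
    rw [he 0 rfl, smul_smul, mul_inv_cancel₀ (norm_ne_zero_iff.2 hβ), one_smul]
  conv_lhs => rw [h0]
  rw [map_smul, OrthonormalBasis.repr_self]
  ext i
  simp [PiLp.single_apply]

end Rows

lemma rho_add_sub_lt {a d : ℝ} (hd : 0 < d) : rho (a + d) - (a + d) < rho a - a := by
  have h1 : rho (a + d) < rho a + d := by
    rw [rho, rho, ← Real.log_exp d, ← Real.log_mul (by positivity) (by positivity), Real.log_exp]
    refine Real.log_lt_log (by positivity) ?_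
    have := Real.one_lt_exp_iff.2 hd
    rw [Real.exp_add]
    linarith
  linarith

lemma rho_lt_rho {a b : ℝ} (hab : a < b) : rho a < rho b := by
  rw [rho, rho]
  have := Real.exp_lt_exp.2 hab
  exact Real.log_lt_log (by positivity) (by linarith)

lemma rho'_pos (x : ℝ) : 0 < rho' x := by unfold rho'; positivity

lemma rho'_le_one (x : ℝ) : rho' x ≤ 1 := by
  rw [rho', div_le_one (by positivity)]
  linarith

lemma one_sub_rho' (x : ℝ) : 1 - rho' x = rho' (-x) := by
  have := Real.exp_pos x
  rw [rho', rho', Real.exp_neg]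
  field_simp
  ring

lemma continuous_rho' : Continuous rho' := by
  unfold rho'
  exact Real.continuous_exp.div (by fun_prop) fun x => by positivity

/-- Complete separation of the responses excludes a minimizer of the likelihood. -/
lemma not_exists_minimizer {n p : ℕ} (hn : n ≠ 0) {X : Fin n → Fin p → ℝ} {y : Fin n → ℝ}
    (hy : ∀ i, y i = 1 ∨ y i = 0) {d : Fin p → ℝ}
    (hd : ∀ i, 0 < (2 * y i - 1) * ∑ j, X i j * d j) :
    ¬ ∃ b, ∀ b', negLogLik X y b ≤ negLogLik X y b' := by
  rintro ⟨b, hb⟩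
  refine (hb (b + d)).not_gt (Finset.sum_lt_sum_of_nonempty ⟨⟨0, Nat.pos_of_ne_zero hn⟩, by simp⟩
    fun i _ => ?_)
  have he : ∑ j, X i j * (b + d) j = ∑ j, X i j * b j + ∑ j, X i j * d j := by
    rw [← Finset.sum_add_distrib]
    exact Finset.sum_congr rfl fun j _ => by rw [Pi.add_apply, mul_add]
  have h := hd i
  rw [he]
  rcases hy i with h1 | h1 <;> rw [h1] at h ⊢
  · simpa using rho_add_sub_lt (a := ∑ j, X i j * b j) (by linarith)
  · simpa using rho_lt_rho (a := ∑ j, X i j * b j + ∑ j, X i j * d j) (by linarith)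

/-- The signed response attached to the standardized signal `q` and the uniform variable `u`. -/
def signResp (g q u : ℝ) : ℝ := if u ≤ rho' (g * q) then 1 else -1

lemma measurable_signResp (g : ℝ) : Measurable fun x : ℝ × ℝ => signResp g x.1 x.2 :=
  Measurable.ite (measurableSet_le measurable_snd
    (continuous_rho'.measurable.comp (measurable_fst.const_mul g))) measurable_const measurable_const

lemma signResp_sq (g q u : ℝ) : signResp g q u ^ 2 = 1 := by
  unfold signResp; split_ifs <;> norm_num

instance : IsProbabilityMeasure unif := ⟨by simp [unif]⟩

instance : IsProbabilityMeasure gauss := by unfold gauss; infer_instance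

section Flip

variable {n : ℕ}

/-- Componentwise product. -/
def flipSign (s : Fin n → ℝ) (h : EuclideanSpace ℝ (Fin n)) : EuclideanSpace ℝ (Fin n) :=
  WithLp.toLp 2 fun i => s i * h i

lemma measurePreserving_flipSign {s : Fin n → ℝ} (hs : ∀ i, s i ^ 2 = 1) :
    MeasurePreserving (flipSign s) (stdGaussian _) (stdGaussian _) := by
  have h1 : ∀ i, MeasurePreserving (fun x : ℝ => s i * x) (gaussianReal 0 1) (gaussianReal 0 1) := by
    intro i
    refine ⟨by fun_prop, ?_⟩
    rw [gaussianReal_map_const_mul, mul_zero]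
    congr 1
    ext
    simp [hs i]
  exact ((measurePreserving_toLp _).comp (measurePreserving_pi _ _ h1)).comp
    (measurePreserving_ofLp _)

/-- Pairs consisting of a vector and a family that together span no strictly positive vector. -/
def nonSeparable (n m : ℕ) : Set (EuclideanSpace ℝ (Fin n) × (Fin m → EuclideanSpace ℝ (Fin n))) :=
  {x | ¬ ∃ (t : ℝ) (c : Fin m → ℝ), ∀ i, 0 < t * x.1 i + ∑ j, c j * x.2 j i}

lemma isClosed_nonSeparable (n m : ℕ) : IsClosed (nonSeparable n m) := by
  rw [← isOpen_compl_iff]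
  have : (nonSeparable n m)ᶜ = ⋃ (t : ℝ) (c : Fin m → ℝ), ⋂ i,
      {x | 0 < t * x.1 i + ∑ j, c j * x.2 j i} := by
    ext x; simp [nonSeparable]
  rw [this]
  exact isOpen_iUnion fun t => isOpen_iUnion fun c => isOpen_iInter_of_finite fun i =>
    isOpen_lt continuous_const (by fun_prop)

/-- Signs of the responses. -/
def signs (g : ℝ) (Q : EuclideanSpace ℝ (Fin n)) (U : Fin n → ℝ) : Fin n → ℝ :=
  fun i => signResp g (Q i) (U i)

/-- The exponential moment governing the separation probability. -/
def expMoment (g k t : ℝ) : ℝ≥0∞ := ∫⁻ u, ∫⁻ q, ∫⁻ z, ENNReal.ofReal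
  (Real.exp (k * (max (z - t * (signResp g q u * q)) 0) ^ 2)) ∂gauss ∂gauss ∂unif

lemma measure_nonSeparable_le {l k : ℝ} (hl : 0 < l) (hl' : l ≤ 1 / 100) (hlk : l < k)
    (g t : ℝ) (m : ℕ) :
    (((stdGaussian (EuclideanSpace ℝ (Fin n))).prod (Measure.pi fun _ : Fin m => stdGaussian _)).prod
      (Measure.pi fun _ => unif)) {x | (flipSign (signs g x.1.1 x.2) x.1.1,
        fun j => flipSign (signs g x.1.1 x.2) (x.1.2 j)) ∈ nonSeparable n m} ≤
      (posPartMoment l)⁻¹ * (ENNReal.ofReal √(1 - 2 * l) ^ m * (ENNReal.ofReal (k - l)⁻¹ *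
        expMoment g k t ^ n)) := by
  have hs : Measurable fun x : (EuclideanSpace ℝ (Fin n) ×
      (Fin m → EuclideanSpace ℝ (Fin n))) × (Fin n → ℝ) => signs g x.1.1 x.2 :=
    measurable_pi_lambda _ fun i => (measurable_signResp g).comp
      (show Measurable fun x : (EuclideanSpace ℝ (Fin n) ×
        (Fin m → EuclideanSpace ℝ (Fin n))) × (Fin n → ℝ) => (x.1.1 i, x.2 i) by fun_prop)
  have hmeas : MeasurableSet {x : (EuclideanSpace ℝ (Fin n) ×
      (Fin m → EuclideanSpace ℝ (Fin n))) × (Fin n → ℝ) | (flipSign (signs g x.1.1 x.2) x.1.1,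
        fun j => flipSign (signs g x.1.1 x.2) (x.1.2 j)) ∈ nonSeparable n m} := by
    refine (isClosed_nonSeparable n m).measurableSet.preimage (f := fun x : (EuclideanSpace ℝ (Fin n) ×
      (Fin m → EuclideanSpace ℝ (Fin n))) × (Fin n → ℝ) => (flipSign (signs g x.1.1 x.2) x.1.1,
        fun j => flipSign (signs g x.1.1 x.2) (x.1.2 j))) ?_
    unfold flipSign
    fun_prop
  have hF : Measurable fun x : ℝ × ℝ => ∫⁻ z, ENNReal.ofReal
      (Real.exp (k * (max (z - t * (signResp g x.2 x.1 * x.2)) 0) ^ 2)) ∂gauss := by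
    refine Measurable.lintegral_prod_right' (f := fun x : (ℝ × ℝ) × ℝ => ENNReal.ofReal
      (Real.exp (k * (max (x.2 - t * (signResp g x.1.2 x.1.1 * x.1.2)) 0) ^ 2))) ?_
    have : Measurable fun x : (ℝ × ℝ) × ℝ => signResp g x.1.2 x.1.1 :=
      (measurable_signResp g).comp (show Measurable fun x : (ℝ × ℝ) × ℝ => (x.1.2, x.1.1)
        by fun_prop)
    fun_prop
  set F : ℝ × ℝ → ℝ≥0∞ := fun x => ∫⁻ z, ENNReal.ofReal
      (Real.exp (k * (max (z - t * (signResp g x.2 x.1 * x.2)) 0) ^ 2)) ∂gauss with hFdef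
  have hprod : ∫⁻ U : Fin n → ℝ, ∫⁻ Q : EuclideanSpace ℝ (Fin n), ∏ i, F (U i, Q i) ∂stdGaussian _
      ∂(Measure.pi fun _ => unif) = expMoment g k t ^ n := by
    have h1 : ∀ U : Fin n → ℝ, ∫⁻ Q : EuclideanSpace ℝ (Fin n), ∏ i, F (U i, Q i) ∂stdGaussian _ =
        ∏ i, ∫⁻ q, F (U i, q) ∂gauss := by
      intro U
      rw [← map_pi_eq_stdGaussian, lintegral_map (by fun_prop) (by fun_prop)]
      exact lintegral_pi_prod gauss (fun i q => F (U i, q)) fun i => by fun_prop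
    simp_rw [h1]
    rw [lintegral_pi_prod unif (fun _ u => ∫⁻ q, F (u, q) ∂gauss)
      fun _ => hF.lintegral_prod_right', Finset.prod_const, Finset.card_univ, Fintype.card_fin]
    rfl
  rw [Measure.prod_apply_symm hmeas, ← hprod, ← mul_assoc, ← mul_assoc]
  have hC : (posPartMoment l)⁻¹ * ENNReal.ofReal √(1 - 2 * l) ^ m * ENNReal.ofReal (k - l)⁻¹ ≠ ∞ :=
    ENNReal.mul_ne_top (ENNReal.mul_ne_top (ENNReal.inv_ne_top.2 (posPartMoment_ne_zero l))
      (ENNReal.pow_ne_top ENNReal.ofReal_ne_top)) ENNReal.ofReal_ne_top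
  rw [← lintegral_const_mul' _ _ hC]
  refine lintegral_mono fun U => ?_
  rw [← lintegral_const_mul' _ _ hC, Measure.prod_apply (hmeas.preimage (by fun_prop))]
  refine lintegral_mono fun Q => ?_
  have hfl := measurePreserving_pi (fun _ : Fin m => stdGaussian (EuclideanSpace ℝ (Fin n)))
    (fun _ => stdGaussian _) fun _ => measurePreserving_flipSign (s := signs g Q U)
      fun i => signResp_sq _ _ _
  have hsec : MeasurableSet {G | (flipSign (signs g Q U) Q, G) ∈ nonSeparable n m} :=
    (isClosed_nonSeparable n m).measurableSet.preimage measurable_prodMk_left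
  refine ((hfl.measure_preimage hsec.nullMeasurableSet).trans_le
    (measure_not_exists_pos_le hl hl' hlk t (flipSign (signs g Q U) Q) m)).trans_eq ?_
  rw [mul_assoc, mul_assoc]
  rfl

end Flip

lemma two_mul_resp_sub_one {n p : ℕ} (X : Fin n → Fin p → ℝ) (U : Fin n → ℝ) (β : Fin p → ℝ)
    {g q : ℝ} (i : Fin n) (h : ∑ j, X i j * β j = g * q) :
    2 * resp X U β i - 1 = signResp g q (U i) := by
  unfold resp signResp
  rw [h]
  split_ifs <;> norm_num

/-- Upper bound for the probability that the maximum likelihood estimator exists. -/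
lemma designLaw_exists_minimizer_le {n m : ℕ} (hn : n ≠ 0) {β : Fin (m + 1) → ℝ}
    (hβ : 0 < ∑ j, β j ^ 2) {l k : ℝ} (hl : 0 < l) (hl' : l ≤ 1 / 100) (hlk : l < k) (t : ℝ) :
    designLaw n (m + 1) {x | ∃ b, ∀ b', negLogLik x.1 (resp x.1 x.2 β) b ≤
        negLogLik x.1 (resp x.1 x.2 β) b'} ≤
      (posPartMoment l)⁻¹ * (ENNReal.ofReal √(1 - 2 * l) ^ m * (ENNReal.ofReal (k - l)⁻¹ *
        expMoment √((∑ j, β j ^ 2) / n) k t ^ n)) := by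
  have hn0 : (0 : ℝ) < √n := Real.sqrt_pos.2 (by positivity)
  have hnorm : ‖(WithLp.toLp 2 β : EuclideanSpace ℝ (Fin (m + 1)))‖ = √(∑ j, β j ^ 2) := by
    simp [EuclideanSpace.norm_eq]
  obtain ⟨f, hf⟩ := exists_isometry_map_eq_single (WithLp.toLp 2 β) (by
    rw [← norm_pos_iff, hnorm]
    exact Real.sqrt_pos.2 hβ)
  rw [hnorm] at hf
  have hmp := ((measurePreserving_piFinSuccAbove
    (fun _ : Fin (m + 1) => stdGaussian (EuclideanSpace ℝ (Fin n))) 0).comp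
    (measurePreserving_rotateDesign hn f)).prod (MeasurePreserving.id (Measure.pi fun _ : Fin n => unif))
  have hle := Measure.le_map_apply (μ := designLaw n (m + 1)) hmp.measurable.aemeasurable
    {x | (flipSign (signs √((∑ j, β j ^ 2) / n) x.1.1 x.2) x.1.1,
        fun j => flipSign (signs √((∑ j, β j ^ 2) / n) x.1.1 x.2) (x.1.2 j)) ∈ nonSeparable n m}
  rw [designLaw, hmp.map_eq] at hle
  refine le_trans (measure_mono ?_) (hle.trans (measure_nonSeparable_le hl hl' hlk _ t m))
  rintro ⟨X, U⟩ hx ⟨t, c, htc⟩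
  have hsig : ∀ i, 2 * resp X U β i - 1 =
      signResp √((∑ j, β j ^ 2) / n) (rotateDesign f X 0 i) (U i) := by
    intro i
    refine two_mul_resp_sub_one X U β i ?_
    have h := sum_mul_eq_sum_rotateRow (n := n) f (X i) β
    rw [hf] at h
    simp only [PiLp.single_apply, mul_ite, mul_zero, Finset.sum_ite_eq', Finset.mem_univ,
      if_true] at h
    rw [Real.sqrt_div' _ (Nat.cast_nonneg n), div_mul_eq_mul_div, eq_div_iff hn0.ne', mul_comm, h,
      mul_comm]
    rfl
  refine not_exists_minimizer hn (y := resp X U β) (fun i => ?_)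
    (d := (f.symm (WithLp.toLp 2 (Fin.cons t c : Fin (m + 1) → ℝ))).ofLp) (fun i => ?_) hx
  · unfold resp; split_ifs <;> simp
  · have h := sum_mul_eq_sum_rotateRow (n := n) f (X i)
      (f.symm (WithLp.toLp 2 (Fin.cons t c : Fin (m + 1) → ℝ))).ofLp
    rw [WithLp.toLp_ofLp, LinearIsometryEquiv.apply_symm_apply, Fin.sum_univ_succ (fun k =>
      rotateRow n f (X i) k * (WithLp.toLp 2 (Fin.cons t c : Fin (m + 1) → ℝ)).ofLp k)] at h
    have hR : ∀ k, rotateRow n f (X i) k = rotateDesign f X k i := fun _ => rfl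
    simp only [Fin.cons_zero, Fin.cons_succ, hR] at h
    refine pos_of_mul_pos_right (a := √n) ?_ hn0.le
    rw [hsig, mul_left_comm, h]
    refine (htc i).trans_eq ?_
    change t * (signResp _ (rotateDesign f X 0 i) (U i) * rotateDesign f X 0 i) + ∑ j, c j *
      (signResp _ (rotateDesign f X 0 i) (U i) * rotateDesign f X j.succ i) = _
    rw [mul_add, Finset.mul_sum]
    refine congrArg₂ (· + ·) ?_ (Finset.sum_congr rfl fun j _ => ?_)
    · ring
    · ring

lemma lintegral_signResp (F : ℝ → ℝ≥0∞) (g q : ℝ) :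
    ∫⁻ u, F (signResp g q u * q) ∂unif =
      ENNReal.ofReal (rho' (g * q)) * F q + ENNReal.ofReal (rho' (-(g * q))) * F (-q) := by
  have h0 := (rho'_pos (g * q)).le
  have h1 := rho'_le_one (g * q)
  have e : ∀ u, F (signResp g q u * q) = (Set.Iic (rho' (g * q))).indicator (fun _ => F q) u +
      (Set.Ioi (rho' (g * q))).indicator (fun _ => F (-q)) u := by
    intro u
    by_cases h : u ≤ rho' (g * q)
    · simp [signResp, h]
    · simp [signResp, h, not_le.1 h]
  have hI : Set.Iic (rho' (g * q)) ∩ Set.Icc 0 1 = Set.Icc 0 (rho' (g * q)) := by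
    ext u; simp only [Set.mem_inter_iff, Set.mem_Iic, Set.mem_Icc]; grind
  have hJ : Set.Ioi (rho' (g * q)) ∩ Set.Icc 0 1 = Set.Ioc (rho' (g * q)) 1 := by
    ext u; simp only [Set.mem_inter_iff, Set.mem_Ioi, Set.mem_Icc, Set.mem_Ioc]; grind
  simp_rw [e]
  rw [lintegral_add_left (measurable_const.indicator measurableSet_Iic),
    lintegral_indicator_const measurableSet_Iic, lintegral_indicator_const measurableSet_Ioi, unif,
    Measure.restrict_apply measurableSet_Iic, Measure.restrict_apply measurableSet_Ioi, hI, hJ,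
    Real.volume_Icc, Real.volume_Ioc, sub_zero, one_sub_rho', mul_comm, mul_comm (F (-q))]

lemma measurePreserving_neg_gauss : MeasurePreserving (fun x : ℝ => -x) gauss gauss :=
  ⟨by fun_prop, by rw [gauss, gaussianReal_map_neg, neg_zero]⟩

lemma lintegral_two_mul_rho' {F : ℝ → ℝ≥0∞} (hF : Measurable F) (g : ℝ) :
    ∫⁻ q, (ENNReal.ofReal (rho' (g * q)) * F q + ENNReal.ofReal (rho' (-(g * q))) * F (-q)) ∂gauss =
      ∫⁻ q, ENNReal.ofReal (2 * rho' (g * q)) * F q ∂gauss := by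
  have hr : Measurable fun q => ENNReal.ofReal (rho' (g * q)) * F q :=
    (continuous_rho'.comp (by fun_prop : Continuous fun q : ℝ => g * q)).measurable.ennreal_ofReal.mul hF
  have h := measurePreserving_neg_gauss.lintegral_comp hr
  simp only [mul_neg] at h
  rw [lintegral_add_left hr, h, ← two_mul, ← lintegral_const_mul' _ _ ENNReal.ofNat_ne_top]
  refine lintegral_congr fun q => ?_
  rw [ENNReal.ofReal_mul zero_le_two, ENNReal.ofReal_ofNat, mul_assoc]

lemma expMoment_eq (g k t : ℝ) :
    expMoment g k t = ∫⁻ x, ENNReal.ofReal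
      (Real.exp (k * (max (x.1 - t * x.2) 0) ^ 2) * (2 * rho' (g * x.2))) ∂(gauss.prod gauss) := by
  have hF : Measurable fun q : ℝ => ∫⁻ z, ENNReal.ofReal
      (Real.exp (k * (max (z - t * q) 0) ^ 2)) ∂gauss :=
    Measurable.lintegral_prod_right' (f := fun x : ℝ × ℝ => ENNReal.ofReal
      (Real.exp (k * (max (x.2 - t * x.1) 0) ^ 2))) (by fun_prop)
  have hs : Measurable fun x : ℝ × ℝ => signResp g x.2 x.1 :=
    (measurable_signResp g).comp measurable_swap
  rw [expMoment, lintegral_lintegral_swap (Measurable.aemeasurable ?_)]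
  · have h1 : ∀ q, ∫⁻ u, ∫⁻ z, ENNReal.ofReal
        (Real.exp (k * (max (z - t * (signResp g q u * q)) 0) ^ 2)) ∂gauss ∂unif = _ := fun q =>
      lintegral_signResp (fun y => ∫⁻ z, ENNReal.ofReal
        (Real.exp (k * (max (z - t * y) 0) ^ 2)) ∂gauss) g q
    simp_rw [h1]
    rw [lintegral_two_mul_rho' hF, lintegral_prod_symm' _ ?_]
    · refine lintegral_congr fun q => ?_
      rw [← lintegral_const_mul' _ _ ENNReal.ofReal_ne_top]
      refine lintegral_congr fun z => ?_
      rw [mul_comm, ← ENNReal.ofReal_mul (Real.exp_pos _).le]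
    · have := continuous_rho'
      exact Measurable.ennreal_ofReal (Continuous.measurable (by fun_prop))
  · exact hF.comp (hs.mul measurable_snd)

/-- The squared positive part `(z - t v)₊²`. -/
def sqPos (t : ℝ) (x : ℝ × ℝ) : ℝ := (max (x.1 - t * x.2) 0) ^ 2

lemma sqPos_nonneg (t : ℝ) (x : ℝ × ℝ) : 0 ≤ sqPos t x := sq_nonneg _

lemma continuous_sqPos (t : ℝ) : Continuous (sqPos t) := by unfold sqPos; fun_prop

lemma sqPos_le (t : ℝ) (x : ℝ × ℝ) : sqPos t x ≤ 2 * x.1 ^ 2 + 2 * t ^ 2 * x.2 ^ 2 := by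
  have h1 : sqPos t x ≤ (x.1 - t * x.2) ^ 2 := by
    unfold sqPos
    rcases le_total (x.1 - t * x.2) 0 with h | h
    · simpa [max_eq_right h] using sq_nonneg _
    · rw [max_eq_left h]
  nlinarith [sq_nonneg (x.1 + t * x.2)]

lemma integrable_exp_sqPos {t k : ℝ} (hk : 0 ≤ k) (h1 : 2 * k < 1 / 2) (h2 : 2 * k * t ^ 2 < 1 / 2) :
    Integrable (fun x => Real.exp (k * sqPos t x)) (gauss.prod gauss) := by
  refine ((integrable_exp_mul_sq_gaussianReal h1).mul_prod
    (integrable_exp_mul_sq_gaussianReal h2)).mono'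
    (Real.continuous_exp.comp ((continuous_sqPos t).const_mul k)).aestronglyMeasurable
    (ae_of_all _ fun x => ?_)
  rw [Real.norm_of_nonneg (Real.exp_pos _).le, ← Real.exp_add]
  refine Real.exp_le_exp.2 ((mul_le_mul_of_nonneg_left (sqPos_le t x) hk).trans_eq ?_)
  ring

/-- Twice the sigmoid, the density of the signed signal with respect to the Gaussian. -/
def weight (g : ℝ) (x : ℝ × ℝ) : ℝ := 2 * rho' (g * x.2)

lemma weight_nonneg (g : ℝ) (x : ℝ × ℝ) : 0 ≤ weight g x :=
  mul_nonneg zero_le_two (rho'_pos _).le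

lemma weight_le_two (g : ℝ) (x : ℝ × ℝ) : weight g x ≤ 2 := by
  have := rho'_le_one (g * x.2)
  rw [weight]; linarith

lemma continuous_weight (g : ℝ) : Continuous (weight g) := by
  have := continuous_rho'
  unfold weight; fun_prop

lemma integrable_mul_weight {f : ℝ × ℝ → ℝ} (hf : Integrable f (gauss.prod gauss)) (g : ℝ) :
    Integrable (fun x => f x * weight g x) (gauss.prod gauss) :=
  hf.mul_bdd (c := 2) (continuous_weight g).aestronglyMeasurable (ae_of_all _ fun x => by
    rw [Real.norm_of_nonneg (weight_nonneg g x)]; exact weight_le_two g x)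

lemma expMoment_eq_ofReal {t k : ℝ} (hk : 0 ≤ k) (h1 : 2 * k < 1 / 2) (h2 : 2 * k * t ^ 2 < 1 / 2)
    (g : ℝ) : expMoment g k t =
      ENNReal.ofReal (∫ x, Real.exp (k * sqPos t x) * weight g x ∂(gauss.prod gauss)) := by
  rw [expMoment_eq, ofReal_integral_eq_lintegral_ofReal
    (integrable_mul_weight (integrable_exp_sqPos hk h1 h2) g)
    (ae_of_all _ fun x => mul_nonneg (Real.exp_pos _).le (weight_nonneg g x))]
  rfl

lemma integral_weight (g : ℝ) : ∫ x, weight g x ∂(gauss.prod gauss) = 1 := by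
  have h := expMoment_eq_ofReal (t := 0) (k := 0) le_rfl (by norm_num) (by norm_num) g
  simp only [expMoment, zero_mul, Real.exp_zero, ENNReal.ofReal_one, lintegral_const, measure_univ,
    mul_one, one_mul] at h
  exact (ENNReal.ofReal_eq_one.1 h.symm)

lemma tendsto_integral_exp_sqPos {t k : ℝ} (hk : 0 ≤ k) (h1 : 2 * k < 1 / 2)
    (h2 : 2 * k * t ^ 2 < 1 / 2) {g : ℕ → ℝ} {γ : ℝ} (hg : Tendsto g atTop (𝓝 γ)) :
    Tendsto (fun n => ∫ x, Real.exp (k * sqPos t x) * weight (g n) x ∂(gauss.prod gauss)) atTop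
      (𝓝 (∫ x, Real.exp (k * sqPos t x) * weight γ x ∂(gauss.prod gauss))) := by
  refine tendsto_integral_of_dominated_convergence (fun x => Real.exp (k * sqPos t x) * 2)
    (fun n => (integrable_mul_weight (integrable_exp_sqPos hk h1 h2) _).aestronglyMeasurable)
    ((integrable_exp_sqPos hk h1 h2).mul_const 2) (fun n => ae_of_all _ fun x => ?_)
    (ae_of_all _ fun x => ?_)
  · rw [Real.norm_of_nonneg (mul_nonneg (Real.exp_pos _).le (weight_nonneg _ x))]
    exact mul_le_mul_of_nonneg_left (weight_le_two _ x) (Real.exp_pos _).le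
  · exact (((continuous_rho'.tendsto _).comp (hg.mul_const x.2)).const_mul 2).const_mul _

lemma exp_le_one_add_add_sq_mul_exp {x : ℝ} (hx : 0 ≤ x) :
    Real.exp x ≤ 1 + x + x ^ 2 * Real.exp x := by
  have h1 : Real.exp x - 1 ≤ x * Real.exp x := by
    have h := mul_le_mul_of_nonneg_right (Real.one_sub_le_exp_neg x) (Real.exp_pos x).le
    rw [← Real.exp_add, neg_add_cancel, Real.exp_zero] at h
    linarith
  nlinarith [mul_le_mul_of_nonneg_left h1 hx]

/-- Second-order expansion of the exponential moment near zero. -/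
lemma exists_integral_exp_sqPos_le (t γ : ℝ) :
    ∃ k₀ > 0, 2 * k₀ < 1 / 2 ∧ 2 * k₀ * t ^ 2 < 1 / 2 ∧ ∃ C, 0 ≤ C ∧ ∀ k, 0 ≤ k → k ≤ k₀ →
      ∫ x, Real.exp (k * sqPos t x) * weight γ x ∂(gauss.prod gauss) ≤
        1 + k * (∫ z, ∫ v, (max (z - t * v) 0) ^ 2 * (2 * rho' (γ * v)) ∂gauss ∂gauss) +
          k ^ 2 * C := by
  have ht : 0 < 1 + t ^ 2 := by positivity
  obtain ⟨k₀, hk₀, h1, h2⟩ : ∃ k₀ > 0, 2 * (2 * k₀) < 1 / 2 ∧ 2 * (2 * k₀) * t ^ 2 < 1 / 2 := by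
    refine ⟨1 / (16 * (1 + t ^ 2)), by positivity, ?_, ?_⟩
    · rw [one_div, mul_inv]
      have := inv_le_one_of_one_le₀ (show (1 : ℝ) ≤ 1 + t ^ 2 by nlinarith)
      linarith
    · field_simp
      nlinarith
  have hI := integrable_exp_sqPos (by linarith) h1 h2
  have hm : ∀ f : ℝ → ℝ, Continuous f →
      AEStronglyMeasurable (fun x => f (sqPos t x)) (gauss.prod gauss) := fun f hf =>
    (hf.comp (continuous_sqPos t)).aestronglyMeasurable
  have hI1 : Integrable (sqPos t) (gauss.prod gauss) := by
    refine (hI.const_mul (2 * k₀)⁻¹).mono' (hm id continuous_id) (ae_of_all _ fun x => ?_)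
    rw [Real.norm_of_nonneg (sqPos_nonneg t x), inv_mul_eq_div, le_div_iff₀ (by positivity)]
    linarith [Real.add_one_le_exp (2 * k₀ * sqPos t x)]
  have hI2 : Integrable (fun x => sqPos t x ^ 2 * Real.exp (k₀ * sqPos t x)) (gauss.prod gauss) := by
    refine (hI.const_mul (2 / k₀ ^ 2)).mono' (hm (fun y => y ^ 2 * Real.exp (k₀ * y)) (by fun_prop))
      (ae_of_all _ fun x => ?_)
    have h0 := sqPos_nonneg t x
    rw [Real.norm_of_nonneg (by positivity), div_mul_eq_mul_div, le_div_iff₀ (by positivity),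
      show 2 * k₀ * sqPos t x = k₀ * sqPos t x + k₀ * sqPos t x by ring, Real.exp_add]
    have := Real.quadratic_le_exp_of_nonneg (mul_nonneg hk₀.le h0)
    have : (k₀ * sqPos t x) ^ 2 ≤ 2 * Real.exp (k₀ * sqPos t x) := by
      nlinarith [mul_nonneg hk₀.le h0]
    nlinarith [mul_le_mul_of_nonneg_right this (Real.exp_pos (k₀ * sqPos t x)).le]
  have hc : ∫ z, ∫ v, (max (z - t * v) 0) ^ 2 * (2 * rho' (γ * v)) ∂gauss ∂gauss =
      ∫ x, sqPos t x * weight γ x ∂(gauss.prod gauss) :=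
    (integral_prod _ (integrable_mul_weight hI1 γ)).symm
  refine ⟨k₀, hk₀, by linarith, by nlinarith [mul_nonneg hk₀.le (sq_nonneg t)],
    ∫ x, sqPos t x ^ 2 * Real.exp (k₀ * sqPos t x) * weight γ x ∂(gauss.prod gauss),
    integral_nonneg fun x => mul_nonneg (by positivity) (weight_nonneg γ x), fun k hk hkk => ?_⟩
  have hw := integrable_mul_weight (integrable_const (1 : ℝ)) γ
  simp only [one_mul] at hw
  have e1 := (integrable_mul_weight hI1 γ).const_mul k
  have e2 := (integrable_mul_weight hI2 γ).const_mul (k ^ 2)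
  have e12 : Integrable (fun x => weight γ x + k * (sqPos t x * weight γ x)) (gauss.prod gauss) :=
    hw.add e1
  rw [hc, ← integral_weight γ, ← integral_const_mul, ← integral_const_mul, ← integral_add hw e1,
    ← integral_add e12 e2]
  refine integral_mono (integrable_mul_weight (integrable_exp_sqPos hk (by linarith)
    (by nlinarith [sq_nonneg t])) γ) (e12.add e2) fun x => ?_
  have h0 := sqPos_nonneg t x
  have h3 := exp_le_one_add_add_sq_mul_exp (mul_nonneg hk h0)
  have h4 : Real.exp (k * sqPos t x) ≤ Real.exp (k₀ * sqPos t x) := by gcongr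
  have h5 : Real.exp (k * sqPos t x) ≤ 1 + k * sqPos t x +
      k ^ 2 * (sqPos t x ^ 2 * Real.exp (k₀ * sqPos t x)) := by
    nlinarith [mul_le_mul_of_nonneg_left h4 (sq_nonneg (k * sqPos t x))]
  refine (mul_le_mul_of_nonneg_right h5 (weight_nonneg γ x)).trans_eq ?_
  ring

lemma sqrt_one_sub_two_mul_le_exp_neg (l : ℝ) : √(1 - 2 * l) ≤ Real.exp (-l) := by
  refine Real.sqrt_le_iff.2 ⟨(Real.exp_pos _).le, ?_⟩
  rw [← Real.exp_nat_mul]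
  have := Real.one_sub_le_exp_neg (2 * l)
  calc 1 - 2 * l ≤ Real.exp (-(2 * l)) := this
    _ = _ := by congr 1; push_cast; ring

/-- Exponential bound on the probability that the maximum-likelihood estimator exists. -/
lemma designLaw_exists_minimizer_le_exp {n p : ℕ} (hn : n ≠ 0) (hp : p ≠ 0) {β : Fin p → ℝ}
    (hβ : 0 < ∑ j, β j ^ 2) {l k t r : ℝ} (hl : 0 < l) (hl' : l ≤ 1 / 100) (hlk : l < k)
    (hr : expMoment √((∑ j, β j ^ 2) / n) k t ≤ ENNReal.ofReal (Real.exp r)) :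
    designLaw n p {x | ∃ b : Fin p → ℝ, ∀ b' : Fin p → ℝ,
        negLogLik x.1 (resp x.1 x.2 β) b ≤ negLogLik x.1 (resp x.1 x.2 β) b'} ≤
      (posPartMoment l)⁻¹ * ENNReal.ofReal (k - l)⁻¹ *
        ENNReal.ofReal (Real.exp (n * r - l * (p - 1))) := by
  obtain ⟨m, rfl⟩ := Nat.exists_eq_succ_of_ne_zero hp
  refine (designLaw_exists_minimizer_le hn hβ hl hl' hlk t).trans ?_
  have h1 : ENNReal.ofReal √(1 - 2 * l) ^ m ≤ ENNReal.ofReal (Real.exp (m * -l)) := by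
    rw [Real.exp_nat_mul, ENNReal.ofReal_pow (Real.exp_pos _).le]
    gcongr
    exact sqrt_one_sub_two_mul_le_exp_neg l
  have h2 : expMoment √((∑ j, β j ^ 2) / n) k t ^ n ≤ ENNReal.ofReal (Real.exp (n * r)) := by
    rw [Real.exp_nat_mul, ENNReal.ofReal_pow (Real.exp_pos _).le]
    gcongr
  have h3 : Real.exp (n * r - l * (((m + 1 : ℕ) : ℝ) - 1)) =
      Real.exp (m * -l) * Real.exp (n * r) := by
    rw [← Real.exp_add]; congr 1; push_cast; ring
  rw [Nat.succ_eq_add_one, h3, ENNReal.ofReal_mul (Real.exp_pos _).le]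
  calc _ ≤ (posPartMoment l)⁻¹ * (ENNReal.ofReal (Real.exp (m * -l)) *
        (ENNReal.ofReal (k - l)⁻¹ * ENNReal.ofReal (Real.exp (n * r)))) := by gcongr
    _ = _ := by ring

/-- If `gMLEinv γ < κ`, some exponential moment is eventually at most `e^{k r}` with `r < κ`. -/
lemma exists_expMoment_le {γ κ : ℝ} (hsig : gMLEinv γ < κ) :
    ∃ t k r : ℝ, 0 < k ∧ k ≤ 1 / 100 ∧ 0 < r ∧ r < κ ∧
      ∀ g : ℕ → ℝ, Tendsto g atTop (𝓝 γ) →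
        ∀ᶠ n in atTop, expMoment (g n) k t ≤ ENNReal.ofReal (Real.exp (k * r)) := by
  obtain ⟨t, ht⟩ := exists_lt_of_ciInf_lt hsig
  obtain ⟨k₀, hk₀, h1, h2, C, hC, hle⟩ := exists_integral_exp_sqPos_le t γ
  set c := ∫ z, ∫ v, (max (z - t * v) 0) ^ 2 * (2 * rho' (γ * v)) ∂gauss ∂gauss
  have hc : 0 ≤ c := integral_nonneg fun z => integral_nonneg fun v =>
    mul_nonneg (sq_nonneg _) (mul_nonneg zero_le_two (rho'_pos _).le)
  obtain ⟨k, hk, hkk₀, hk100, hkκ⟩ : ∃ k > 0, k ≤ k₀ ∧ k ≤ 1 / 100 ∧ k * (C + 1) < κ - c := by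
    refine ⟨min k₀ (min (1 / 100) ((κ - c) / (2 * (C + 1)))),
      lt_min hk₀ (lt_min (by norm_num) (div_pos (by linarith) (by linarith))),
      min_le_left _ _, (min_le_right _ _).trans (min_le_left _ _), ?_⟩
    have h : min k₀ (min (1 / 100) ((κ - c) / (2 * (C + 1)))) ≤ (κ - c) / (2 * (C + 1)) :=
      (min_le_right _ _).trans (min_le_right _ _)
    rw [le_div_iff₀ (by linarith)] at h
    linarith
  have hk1 : 2 * k < 1 / 2 := by linarith
  have hk2 : 2 * k * t ^ 2 < 1 / 2 := by nlinarith [sq_nonneg t]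
  refine ⟨t, k, c + k * (C + 1), hk, hk100, by positivity, by linarith, fun g hg => ?_⟩
  have hlt : ∫ x, Real.exp (k * sqPos t x) * weight γ x ∂(gauss.prod gauss) <
      Real.exp (k * (c + k * (C + 1))) := by
    refine (hle k hk.le hkk₀).trans_lt ?_
    nlinarith [Real.add_one_le_exp (k * (c + k * (C + 1))), mul_pos hk hk]
  filter_upwards [(tendsto_integral_exp_sqPos hk.le hk1 hk2 hg).eventually_le_const hlt] with n hn
  rw [expMoment_eq_ofReal hk.le hk1 hk2]
  exact ENNReal.ofReal_le_ofReal hn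

/-- If `γ > g_MLE(κ)` (equivalently `κ > g_MLE⁻¹(γ)`), then in the
high-dimensional logistic model with `p/n → κ`, i.i.d. `N(0, n⁻¹ I_p)` rows and
`‖β‖²/n → γ²`, the probability that the MLE exists tends to `0`. -/
theorem mle_asymptotically_does_not_exist
    (κ γ : ℝ) (hκ : κ ∈ Set.Ioo (0 : ℝ) 1) (hγ : 0 < γ)
    (hsig : gMLEinv γ < κ)
    (p : ℕ → ℕ) (hp : Tendsto (fun n => (p n : ℝ) / n) atTop (𝓝 κ))
    {Ω : Type*} [MeasurableSpace Ω] (μ : Measure Ω) [IsProbabilityMeasure μ]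
    (X : (n : ℕ) → Ω → Fin n → Fin (p n) → ℝ) (U : (n : ℕ) → Ω → Fin n → ℝ)
    (hmeas : ∀ n, Measurable (fun ω => (X n ω, U n ω)))
    (hlaw : ∀ n, Measure.map (fun ω => (X n ω, U n ω)) μ = designLaw n (p n))
    (β : (n : ℕ) → Fin (p n) → ℝ)
    (hβ : Tendsto (fun n => (∑ j, (β n j) ^ 2) / n) atTop (𝓝 (γ ^ 2))) :
    Tendsto
      (fun n => μ {ω | ∃ b : Fin (p n) → ℝ, ∀ b' : Fin (p n) → ℝ,
        negLogLik (X n ω) (resp (X n ω) (U n ω) (β n)) b ≤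
          negLogLik (X n ω) (resp (X n ω) (U n ω) (β n)) b'})
      atTop (𝓝 0) := by
  obtain ⟨t, k, r, hk, hk', hr, hrκ, hM⟩ := exists_expMoment_le hsig
  obtain ⟨κ₁, hκ₁, hκ₁κ⟩ := exists_between hrκ
  obtain ⟨κ₂, hκ₂, hκ₂κ⟩ := exists_between hκ₁κ
  have hκ₁pos : 0 < κ₁ := hr.trans hκ₁
  have hκ₂pos : 0 < κ₂ := hκ₁pos.trans hκ₂
  set l := k * κ₁ / κ₂ with hl_def
  have hl : 0 < l := by positivity
  have hlκ : l * κ₂ = k * κ₁ := div_mul_cancel₀ _ hκ₂pos.ne'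
  have hlk : l < k := by rw [hl_def, div_lt_iff₀ hκ₂pos]; gcongr
  have hl' : l ≤ 1 / 100 := hlk.le.trans hk'
  have hg : Tendsto (fun n => √((∑ j, (β n j) ^ 2) / n)) atTop (𝓝 γ) := by
    simpa [Real.sqrt_sq hγ.le] using hβ.sqrt
  have hp' : Tendsto (fun n : ℕ => (p n : ℝ) / n - 1 / n) atTop (𝓝 κ) := by
    simpa using hp.sub tendsto_one_div_atTop_nhds_zero_nat
  have hlim : Tendsto (fun n : ℕ => (posPartMoment l)⁻¹ * ENNReal.ofReal (k - l)⁻¹ *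
      ENNReal.ofReal (Real.exp (-(k * (κ₁ - r) * n)))) atTop (𝓝 0) := by
    have h : Tendsto (fun n : ℕ => Real.exp (-(k * (κ₁ - r) * n))) atTop (𝓝 0) :=
      Real.tendsto_exp_neg_atTop_nhds_zero.comp (tendsto_natCast_atTop_atTop.const_mul_atTop
        (mul_pos hk (sub_pos.2 hκ₁)))
    have h' := ENNReal.Tendsto.const_mul (ENNReal.tendsto_ofReal h)
      (Or.inr (ENNReal.mul_ne_top (ENNReal.inv_ne_top.2 (posPartMoment_ne_zero l))
        (ENNReal.ofReal_ne_top (r := (k - l)⁻¹))))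
    simpa only [ENNReal.ofReal_zero, mul_zero] using h'
  refine tendsto_of_tendsto_of_tendsto_of_le_of_le' tendsto_const_nhds hlim
    (Eventually.of_forall fun _ => zero_le) ?_
  filter_upwards [eventually_ne_atTop 0, hp'.eventually_const_le hκ₂κ, hM _ hg,
    hβ.eventually_const_lt (pow_pos hγ 2)] with n hn hpn hMn hβn
  have hn' : (0 : ℝ) < n := by exact_mod_cast Nat.pos_of_ne_zero hn
  have hβ0 : 0 < ∑ j, (β n j) ^ 2 := by rwa [div_pos_iff_of_pos_right hn'] at hβn
  rw [← sub_div, le_div_iff₀ hn'] at hpn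
  have hp0 : p n ≠ 0 := fun h => by
    rw [h, Nat.cast_zero] at hpn
    nlinarith [mul_pos hκ₂pos hn']
  refine (Measure.le_map_apply (hmeas n).aemeasurable {x | ∃ b : Fin (p n) → ℝ,
    ∀ b' : Fin (p n) → ℝ, negLogLik x.1 (resp x.1 x.2 (β n)) b ≤
      negLogLik x.1 (resp x.1 x.2 (β n)) b'}).trans ?_
  rw [hlaw n]
  refine (designLaw_exists_minimizer_le_exp hn hp0 hβ0 hl hl' hlk hMn).trans ?_
  gcongr
  nlinarith [mul_le_mul_of_nonneg_left hpn hl.le]
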